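/- arXiv:2004.11972 — 3 statements merged into one kernel-verified Lean document; each statement's English description precedes it below -/
import Mathlib

section
/- Let L be a geometric lattice of finite height, let p be an atom of L and h a hyperplane of L with p ≰ h. Then the cardinality of the set of atoms below h is at most the cardinality of the set of hyperplanes above p. -/
universe u

/-- An element of a poset is an *atom* (point) if it is an upper cover of a least element. -/
def IsAtomP {P : Type*} [PartialOrder P] (a : P) : Prop :=
  ∃ z : P, (∀ w, z ≤ w) ∧ z ⋖ a

/-- An element of a poset is a *coatom* (hyperplane) if it is a lower cover of a greatest
element. -/
def IsCoatomP {P : Type*} [PartialOrder P] (a : P) : Prop :=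
  ∃ z : P, (∀ w, w ≤ z) ∧ a ⋖ z

/-- A partial order is a *geometric lattice of finite height* if it is a lattice
(binary joins and meets exist), has no infinite chains, is semimodular, and every
element is a join (least upper bound) of a set of atoms. -/
def IsGeomLatFH (P : Type*) [PartialOrder P] : Prop :=
  (∀ x y : P, ∃ z, IsLUB {x, y} z) ∧
  (∀ x y : P, ∃ z, IsGLB {x, y} z) ∧
  (∀ c : Set P, IsChain (· ≤ ·) c → c.Finite) ∧
  (∀ a b c : P, a ⋖ b → a ⋖ c → b ≠ c → ∃ d, b ⋖ d ∧ c ⋖ d) ∧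
  (∀ x : P, ∃ S : Set P, (∀ a ∈ S, IsAtomP a) ∧ IsLUB S x)

/-- `r` is the rank (height) function of a graded bounded poset: `r ⊥ = 0` and `r`
increases by exactly one across covering pairs. -/
def IsRankFn {L : Type*} [PartialOrder L] [OrderBot L] (r : L → ℕ) : Prop :=
  r ⊥ = 0 ∧ ∀ x y : L, x ⋖ y → r y = r x + 1

/-- A *matching* of a lattice: an injection from atoms to coatoms (hyperplanes) such
that each atom lies below its image. -/
def HasMatching (L : Type*) [CompleteLattice L] : Prop :=
  ∃ f : {a : L // IsAtom a} → {h : L // IsCoatom h},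
    Function.Injective f ∧ ∀ a : {a : L // IsAtom a}, (a : L) ≤ ((f a : {h : L // IsCoatom h}) : L)

/-- Counting lemma (Conway's argument) for finite incidence structures. -/
theorem count_fin {α β : Type u} [Fintype α] [Fintype β] (I : α → β → Prop)
    (h1 : ∀ p, ∃ h, ¬ I p h) (h2 : ∀ h, ∃ p, ¬ I p h) (h3 : ∀ p, ∃ h, I p h)
    (hk : ∀ p h, ¬ I p h → Nat.card {q // I q h} ≤ Nat.card {k // I p k}) :
    Fintype.card α ≤ Fintype.card β := by
  classical
  by_contra! hlt
  set v := Fintype.card α with hv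
  set b := Fintype.card β with hb
  let r : α → ℕ := fun p => (Finset.univ.filter (fun h => I p h)).card
  let k : β → ℕ := fun h => (Finset.univ.filter (fun p => I p h)).card
  have hk' : ∀ p h, ¬ I p h → k h ≤ r p := by
    intro p h hn
    have := hk p h hn
    rwa [Nat.card_eq_fintype_card, Nat.card_eq_fintype_card, Fintype.card_subtype,
      Fintype.card_subtype] at this
  have hr : ∀ p, (Finset.univ.filter (fun h => ¬ I p h)).card + r p = b := by
    intro p
    rw [add_comm]
    exact Finset.card_filter_add_card_filter_not (s := Finset.univ) (fun h => I p h)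
  have hkk : ∀ h, (Finset.univ.filter (fun p => ¬ I p h)).card + k h = v := by
    intro h
    rw [add_comm]
    exact Finset.card_filter_add_card_filter_not (s := Finset.univ) (fun p => I p h)
  have hr1 : ∀ p, 0 < (Finset.univ.filter (fun h => ¬ I p h)).card := by
    intro p
    obtain ⟨h, hh⟩ := h1 p
    exact Finset.card_pos.2 ⟨h, by simpa using hh⟩
  have hk1 : ∀ h, 0 < (Finset.univ.filter (fun p => ¬ I p h)).card := by
    intro h
    obtain ⟨p, hh⟩ := h2 h
    exact Finset.card_pos.2 ⟨p, by simpa using hh⟩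
  have hr0 : ∀ p, 0 < r p := by
    intro p
    obtain ⟨h, hh⟩ := h3 p
    exact Finset.card_pos.2 ⟨h, by simpa using hh⟩
  have hvpos : 0 < v := by omega
  obtain ⟨p0⟩ : Nonempty α := Fintype.card_pos_iff.1 hvpos
  have hbpos : 0 < b := by have := hr p0; have := hr0 p0; omega
  let x : α → ℚ := fun p => ((Finset.univ.filter (fun h => ¬ I p h)).card : ℚ)
  let y : β → ℚ := fun h => ((Finset.univ.filter (fun p => ¬ I p h)).card : ℚ)
  have hx : ∀ p, 0 < x p := fun p => Nat.cast_pos.2 (hr1 p)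
  have hy : ∀ p, 0 < y p := fun p => Nat.cast_pos.2 (hk1 p)
  have hvq : (0 : ℚ) < v := by exact_mod_cast hvpos
  have hbq : (0 : ℚ) < b := by exact_mod_cast hbpos
  have e1 : ∑ p : α, ∑ h : β, (if ¬ I p h then 1 / (v * x p) else 0) = 1 := by
    have : ∀ p : α, ∑ h : β, (if ¬ I p h then 1 / (v * x p) else 0) = 1 / (v : ℚ) := by
      intro p
      rw [← Finset.sum_filter, Finset.sum_const, nsmul_eq_mul]
      change x p * _ = _
      have := hx p
      field_simp
    rw [Finset.sum_congr rfl (fun p _ => this p), Finset.sum_const, nsmul_eq_mul,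
      Finset.card_univ, ← hv]
    field_simp
  have e2 : ∑ p : α, ∑ h : β, (if ¬ I p h then 1 / (b * y h) else 0) = 1 := by
    rw [Finset.sum_comm]
    have : ∀ h : β, ∑ p : α, (if ¬ I p h then 1 / (b * y h) else 0) = 1 / (b : ℚ) := by
      intro h
      rw [← Finset.sum_filter, Finset.sum_const, nsmul_eq_mul]
      change y h * _ = _
      have := hy h
      field_simp
    rw [Finset.sum_congr rfl (fun p _ => this p), Finset.sum_const, nsmul_eq_mul,
      Finset.card_univ, ← hb]
    field_simp
  have key : ∀ p h, ¬ I p h → 1 / (b * y h) < 1 / (v * x p) := by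
    intro p h hn
    apply one_div_lt_one_div_of_lt (mul_pos hvq (hx p))
    have a1 : x p = b - r p := by
      have := hr p
      have h' : x p + r p = b := by simp only [x]; exact_mod_cast this
      linarith
    have a2 : y h = v - k h := by
      have := hkk h
      have h' : y h + k h = v := by simp only [y]; exact_mod_cast this
      linarith
    rw [a1, a2]
    have a3 : (k h : ℚ) ≤ r p := by exact_mod_cast hk' p h hn
    have a4 : (0 : ℚ) < r p := by exact_mod_cast hr0 p
    have a5 : (b : ℚ) < v := by exact_mod_cast hlt
    have a6 : (b : ℚ) * k h ≤ b * r p := mul_le_mul_of_nonneg_left a3 hbq.le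
    have a7 : (b : ℚ) * r p < v * r p := mul_lt_mul_of_pos_right a5 a4
    linarith
  have key' : ∀ p h, (if ¬ I p h then 1 / (b * y h) else 0) ≤
      (if ¬ I p h then 1 / (v * x p) else 0) := by
    intro p h
    by_cases hn : I p h
    · simp [hn]
    · rw [if_pos hn, if_pos hn]; exact (key p h hn).le
  have : ∑ p : α, ∑ h : β, (if ¬ I p h then 1 / (b * y h) else 0) <
      ∑ p : α, ∑ h : β, (if ¬ I p h then 1 / (v * x p) else 0) := by
    apply Finset.sum_lt_sum
    · intro p _
      exact Finset.sum_le_sum (fun h _ => key' p h)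
    · refine ⟨p0, Finset.mem_univ _, ?_⟩
      apply Finset.sum_lt_sum
      · intro h _
        exact key' p0 h
      · obtain ⟨h, hn⟩ := h1 p0
        refine ⟨h, Finset.mem_univ _, ?_⟩
        rw [if_pos hn, if_pos hn]; exact key p0 h hn
  rw [e1, e2] at this
  exact lt_irrefl _ this

/-- Counting lemma for arbitrary incidence structures. -/
theorem count_gen {α β : Type u} (I : α → β → Prop)
    (h1 : ∀ p, ∃ h, ¬ I p h) (h2 : ∀ h, ∃ p, ¬ I p h) (h3 : ∀ p, ∃ h, I p h)
    (hk : ∀ p h, ¬ I p h → Cardinal.mk {q // I q h} ≤ Cardinal.mk {k // I p k}) :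
    Cardinal.mk α ≤ Cardinal.mk β := by
  have hkb : ∀ h, Cardinal.mk {q // I q h} ≤ Cardinal.mk β := by
    intro h
    obtain ⟨p, hp⟩ := h2 h
    exact (hk p h hp).trans (Cardinal.mk_subtype_le _)
  have hbb : Cardinal.mk α ≤ Cardinal.mk β * Cardinal.mk β := by
    have s1 : Cardinal.mk α ≤ Cardinal.mk (Σ h : β, {q // I q h}) := by
      choose f hf using h3
      refine Cardinal.mk_le_of_injective (f := fun p => ⟨f p, p, hf p⟩) ?_
      intro p q hpq
      have := congrArg (fun z : (Σ h : β, {q // I q h}) => z.2.1) hpq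
      simpa using this
    refine s1.trans ?_
    rw [Cardinal.mk_sigma]
    refine (Cardinal.sum_le_sum _ (fun _ => Cardinal.mk β) hkb).trans ?_
    simp
  rcases finite_or_infinite β with hfin | hinf
  · have hα : Finite α := by
      rw [← Cardinal.lt_aleph0_iff_finite]
      have := Cardinal.lt_aleph0_of_finite β
      exact hbb.trans_lt (Cardinal.mul_lt_aleph0 this this)
    have := Fintype.ofFinite α
    have := Fintype.ofFinite β
    rw [Cardinal.mk_fintype, Cardinal.mk_fintype]
    refine Nat.cast_le.2 (count_fin I h1 h2 h3 ?_)
    intro p h hn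
    exact Cardinal.toNat_le_toNat (hk p h hn) (Cardinal.lt_aleph0_of_finite _)
  · rwa [Cardinal.mul_eq_self (Cardinal.aleph0_le_mk β)] at hbb

section Geom

variable {L : Type u} [CompleteLattice L]

theorem covBy_eq_aux {a b c : L} (h : a ⋖ b) (h1 : a < c) (h2 : c ≤ b) : c = b :=
  (h.eq_or_eq h1.le h2).resolve_left h1.ne'

theorem geom_wfGT (hL : IsGeomLatFH L) : WellFoundedGT L := by
  rw [wellFoundedGT_iff_monotone_chain_condition']
  intro a
  by_contra! hcon
  have hfin := hL.2.2.1 (Set.range a) (by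
    rintro _ ⟨m, rfl⟩ _ ⟨n, rfl⟩ _
    rcases le_total m n with h | h
    · exact Or.inl (a.monotone h)
    · exact Or.inr (a.monotone h))
  obtain ⟨m, ⟨n, rfl⟩, hm⟩ := hfin.exists_maximal (Set.range_nonempty a)
  obtain ⟨m', hm', hlt⟩ := hcon n
  exact hlt.not_ge (hm ⟨m', rfl⟩ hlt.le)

theorem geom_wfLT (hL : IsGeomLatFH L) : WellFoundedLT L := by
  have : WellFoundedGT Lᵒᵈ := by
    rw [wellFoundedGT_iff_monotone_chain_condition']
    intro a
    by_contra! hcon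
    have hfin := hL.2.2.1 (Set.range (fun n => OrderDual.ofDual (a n))) (by
      rintro _ ⟨m, rfl⟩ _ ⟨n, rfl⟩ _
      rcases le_total m n with h | h
      · exact Or.inr (a.monotone h)
      · exact Or.inl (a.monotone h))
    obtain ⟨m, ⟨n, rfl⟩, hm⟩ := hfin.exists_minimal (Set.range_nonempty _)
    obtain ⟨m', hm', hlt⟩ := hcon n
    exact hlt.not_ge (hm ⟨m', rfl⟩ hlt.le)
  exact ⟨this.wf⟩

theorem exists_covBy_ge (hL : IsGeomLatFH L) {x t : L} (h : x < t) : ∃ k, x ≤ k ∧ k ⋖ t := by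
  have := geom_wfGT hL
  obtain ⟨m, hm, hmax⟩ := (wellFounded_gt (α := L)).has_min {y | x ≤ y ∧ y < t} ⟨x, le_rfl, h⟩
  refine ⟨m, hm.1, hm.2, ?_⟩
  intro c hc hct
  exact hmax c ⟨hm.1.trans hc.le, hct⟩ hc

theorem atomP_isAtom {a : L} (h : IsAtomP a) : IsAtom a := by
  obtain ⟨z, hz, hza⟩ := h
  have : z = ⊥ := le_bot_iff.1 (hz ⊥)
  subst this
  exact bot_covBy_iff.1 hza

theorem exists_atom_not_le (hL : IsGeomLatFH L) {x t : L} (h : ¬ t ≤ x) :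
    ∃ a, IsAtom a ∧ a ≤ t ∧ ¬ a ≤ x := by
  obtain ⟨S, hS, hlub⟩ := hL.2.2.2.2 t
  by_contra! hcon
  exact h (hlub.2 (fun a ha => hcon a (atomP_isAtom (hS a ha)) (hlub.1 ha)))

theorem covBy_sup_atom (hL : IsGeomLatFH L) {a : L} (ha : IsAtom a) (x : L) :
    ¬ a ≤ x → x ⋖ x ⊔ a := by
  have := geom_wfLT hL
  induction x using WellFoundedLT.induction with
  | ind x ih =>
    intro hax
    by_cases hx : x = ⊥
    · subst hx
      simpa using ha.bot_covBy
    obtain ⟨y, -, hy⟩ := exists_covBy_ge hL (bot_lt_iff_ne_bot.2 hx)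
    have h1 := ih y hy.lt (fun h => hax (h.trans hy.le))
    obtain ⟨d, hd1, hd2⟩ := hL.2.2.2.1 y x (y ⊔ a) hy h1 (by
      intro h
      apply hax
      rw [h]
      exact le_sup_right)
    have h2 : x ⊔ a ≤ d := sup_le hd1.le (le_sup_right.trans hd2.le)
    have h3 : x < x ⊔ a := left_lt_sup.2 hax
    have h4 : x ⊔ a = d := covBy_eq_aux hd1 h3 h2
    rw [h4]
    exact hd1

theorem sup_covBy (hL : IsGeomLatFH L) {p h k t : L} (hp : IsAtom p) (hpt : p ≤ t)
    (hph : ¬ p ≤ h) (hht : h ⋖ t) (hk : k ⋖ h) : k ⊔ p ⋖ t := by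
  obtain ⟨d, hd1, hd2⟩ := hL.2.2.2.1 k h (k ⊔ p) hk
    (covBy_sup_atom hL hp k (fun hc => hph (hc.trans hk.le))) (by
      intro hc
      apply hph
      rw [hc]
      exact le_sup_right)
  have h3 : h < h ⊔ p := left_lt_sup.2 hph
  have e1 : h ⊔ p = d := covBy_eq_aux hd1 h3 (sup_le hd1.le (le_sup_right.trans hd2.le))
  have e2 : h ⊔ p = t := covBy_eq_aux hht h3 (sup_le hht.le hpt)
  rw [← e2, e1]
  exact hd2

theorem sup_inf_eq (hL : IsGeomLatFH L) {p h k : L} (hp : IsAtom p)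
    (hph : ¬ p ≤ h) (hk : k ≤ h) : (k ⊔ p) ⊓ h = k := by
  have hc := covBy_sup_atom hL hp k (fun hc => hph (hc.trans hk))
  have h1 : k ≤ (k ⊔ p) ⊓ h := le_inf le_sup_left hk
  rcases hc.eq_or_eq h1 inf_le_left with h | h
  · exact h
  · exact absurd (le_sup_right.trans (inf_eq_left.1 h)) hph

theorem exists_covBy_not_le (hL : IsGeomLatFH L) {p t : L} (hp : IsAtom p) (hpt : p ≤ t) :
    ∃ h, h ⋖ t ∧ ¬ p ≤ h := by
  have := geom_wfGT hL
  obtain ⟨m, hm, hmax⟩ := (wellFounded_gt (α := L)).has_min {y | y ≤ t ∧ ¬ p ≤ y}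
    ⟨⊥, bot_le, fun h => hp.1 (le_bot_iff.1 h)⟩
  have hc := covBy_sup_atom hL hp m hm.2
  refine ⟨m, ?_, hm.2⟩
  suffices m ⊔ p = t by rwa [this] at hc
  apply le_antisymm (sup_le hm.1 hpt)
  by_contra hcon
  obtain ⟨q, hq, hqt, hqn⟩ := exists_atom_not_le hL hcon
  have hqm : ¬ q ≤ m := fun h => hqn (h.trans le_sup_left)
  have hcq := covBy_sup_atom hL hq m hqm
  by_cases hpq : p ≤ m ⊔ q
  · have : m ⊔ p = m ⊔ q := covBy_eq_aux hcq hc.lt (sup_le le_sup_left hpq)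
    apply hqn
    rw [this]
    exact le_sup_right
  · exact hmax (m ⊔ q) ⟨sup_le hm.1 hqt, hpq⟩ hcq.lt

theorem coatoms_embed (hL : IsGeomLatFH L) {p h t : L} (hp : IsAtom p) (hpt : p ≤ t)
    (hph : ¬ p ≤ h) (hht : h ⋖ t) :
    Cardinal.mk {k : L // k ⋖ h} ≤ Cardinal.mk {k : L // k ⋖ t ∧ p ≤ k} := by
  refine Cardinal.mk_le_of_injective
    (f := fun k => ⟨k.1 ⊔ p, sup_covBy hL hp hpt hph hht k.2, le_sup_right⟩) ?_
  intro k k' hkk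
  have h1 : k.1 ⊔ p = k'.1 ⊔ p := congrArg Subtype.val hkk
  apply Subtype.ext
  rw [← sup_inf_eq hL hp hph k.2.le, h1, sup_inf_eq hL hp hph k'.2.le]

theorem atoms_le_coatoms (hL : IsGeomLatFH L) (t : L) :
    Cardinal.mk {a : L // IsAtom a ∧ a ≤ t} ≤ Cardinal.mk {k : L // k ⋖ t} := by
  have := geom_wfLT hL
  induction t using WellFoundedLT.induction with
  | ind t ih =>
    by_cases ht : IsAtom t
    · refine Cardinal.mk_le_of_injective (f := fun _ => ⟨⊥, ht.bot_covBy⟩) ?_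
      intro a b _
      apply Subtype.ext
      rw [(ht.le_iff_eq a.2.1.1).1 a.2.2, (ht.le_iff_eq b.2.1.1).1 b.2.2]
    refine count_gen (fun a k => a.1 ≤ k.1) ?_ ?_ ?_ ?_
    · rintro ⟨p, hp, hpt⟩
      obtain ⟨h, hh, hn⟩ := exists_covBy_not_le hL hp hpt
      exact ⟨⟨h, hh⟩, hn⟩
    · rintro ⟨h, hh⟩
      obtain ⟨a, ha, hat, hn⟩ := exists_atom_not_le hL hh.lt.not_ge
      exact ⟨⟨a, ha, hat⟩, hn⟩
    · rintro ⟨p, hp, hpt⟩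
      have hlt : p < t := lt_of_le_of_ne hpt (by rintro rfl; exact ht hp)
      obtain ⟨k, hk1, hk2⟩ := exists_covBy_ge hL hlt
      exact ⟨⟨k, hk2⟩, hk1⟩
    · rintro ⟨p, hp, hpt⟩ ⟨h, hh⟩ hn
      have e1 : Cardinal.mk {q : {a : L // IsAtom a ∧ a ≤ t} // q.1 ≤ h} ≤
          Cardinal.mk {a : L // IsAtom a ∧ a ≤ h} := by
        refine Cardinal.mk_le_of_injective (f := fun q => ⟨q.1.1, q.1.2.1, q.2⟩) ?_
        intro a b hab
        exact Subtype.ext (Subtype.ext (congrArg (fun z => z.1) hab))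
      have e2 : Cardinal.mk {k : L // k ⋖ t ∧ p ≤ k} ≤
          Cardinal.mk {k : {k : L // k ⋖ t} // p ≤ k.1} := by
        refine Cardinal.mk_le_of_injective (f := fun q => ⟨⟨q.1, q.2.1⟩, q.2.2⟩) ?_
        intro a b hab
        exact Subtype.ext (congrArg (fun z => z.1.1) hab)
      exact e1.trans ((ih h hh.lt).trans ((coatoms_embed hL hp hpt hn hh).trans e2))

end Geom

/-- If `p` is an atom and `h` a hyperplane of a geometric lattice of finite height with
`p ≰ h`, then there are at most as many atoms below `h` as hyperplanes above `p`. -/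
theorem atoms_below_le_coatoms_above {L : Type u} [CompleteLattice L]
    (hL : IsGeomLatFH L) (p h : L) (hp : IsAtom p) (hh : IsCoatom h) (hph : ¬ p ≤ h) :
    Cardinal.mk {a : L | IsAtom a ∧ a ≤ h} ≤ Cardinal.mk {k : L | IsCoatom k ∧ p ≤ k} := by
  have h1 := (atoms_le_coatoms hL h).trans
    (coatoms_embed hL hp le_top hph (covBy_top_iff.2 hh))
  simp only [covBy_top_iff] at h1
  exact h1
end

section
/- Let λ be a singular cardinal. Assume that every geometric lattice of finite rank at least 2 and of cardinality less than λ has a matching. Then every geometric lattice of finite rank at least 2 and of cardinality λ has a matching. -/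
universe u

namespace SingStep
open Cardinal Set

/-- The closure system data: `E S` is the set of targets supported by `S`. -/
structure Sys (A B : Type u) where
  Adj : A → B → Prop
  E : Set A → Set B
  mono : ∀ {S T : Set A}, S ⊆ T → E S ⊆ E T
  fin : ∀ {S : Set A} {b : B}, b ∈ E S → ∃ F : Set A, F.Finite ∧ F ⊆ S ∧ b ∈ E F
  ctb : ∀ {F : Set A}, F.Finite → (E F).Countable

variable {A B : Type u} (M : Sys A B)

/-- `f` matches `S` into `E S`. -/
def Match (S : Set A) (f : A → B) : Prop :=
  InjOn f S ∧ ∀ a ∈ S, M.Adj a (f a) ∧ f a ∈ M.E S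

/-- `T` is free over `S`. -/
def Ext (S T : Set A) : Prop :=
  ∃ g : A → B, InjOn g (T \ S) ∧ ∀ a ∈ T \ S, M.Adj a (g a) ∧ g a ∈ M.E T ∧ g a ∉ M.E S

inductive Bad (μ : Cardinal.{u}) : Ordinal.{u} → Set A → Prop
  | mk (o : Ordinal.{u}) (S T : Set A) (ρ : Set A → Ordinal.{u}) (hT : #T ≤ μ)
    (h : ∀ T' : Set A, #T' ≤ μ → S ⊆ T' → T ⊆ T' → Ext M S T' → ρ T' < o)
    (h' : ∀ T' : Set A, #T' ≤ μ → S ⊆ T' → T ⊆ T' → Ext M S T' → Bad μ (ρ T') T') : Bad μ o S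

def Good (μ : Cardinal.{u}) (S : Set A) : Prop := #S ≤ μ ∧ ∀ o, ¬ Bad M μ o S

theorem Good.step {μ : Cardinal.{u}} {S : Set A} (hS : Good M μ S) (T : Set A) (hT : #T ≤ μ) :
    ∃ T', S ⊆ T' ∧ T ⊆ T' ∧ Ext M S T' ∧ Good M μ T' := by
  classical
  by_contra hcon
  push Not at hcon
  have h1 : ∀ T' : Set A, ∃ o, #T' ≤ μ → S ⊆ T' → T ⊆ T' → Ext M S T' → Bad M μ o T' := by
    intro T'
    by_cases h : #T' ≤ μ ∧ S ⊆ T' ∧ T ⊆ T' ∧ Ext M S T'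
    · obtain ⟨h1, h2, h3, h4⟩ := h
      have := hcon T' h2 h3 h4
      unfold Good at this
      push Not at this
      obtain ⟨o, ho⟩ := this h1
      exact ⟨o, fun _ _ _ _ => ho⟩
    · exact ⟨0, fun a b c d => absurd ⟨a, b, c, d⟩ h⟩
  choose ρ hρ using h1
  exact hS.2 (⨆ T', ρ T' + 1) (Bad.mk _ S T ρ hT (fun T' _ _ _ _ => Ordinal.lt_iSup_add_one ρ T') hρ)

theorem mk_union_le_of {μ : Cardinal.{u}} (hμ : ℵ₀ ≤ μ) {S T : Set A} (hS : #S ≤ μ) (hT : #T ≤ μ) :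
    #(S ∪ T : Set A) ≤ μ :=
  (mk_union_le S T).trans (add_le_of_le hμ hS hT)

theorem mk_iUnion_le_of {μ : Cardinal.{u}} (hμ : ℵ₀ ≤ μ) {ι : Type u} (hι : #ι ≤ μ) {S : ι → Set A}
    (hS : ∀ i, #(S i) ≤ μ) : #(⋃ i, S i : Set A) ≤ μ := by
  refine (mk_iUnion_le_sum_mk).trans ?_
  refine (sum_le_sum _ (fun _ => μ) hS).trans ?_
  rw [sum_const']
  exact mul_le_of_le hμ hι le_rfl

theorem mk_E_le {μ : Cardinal.{u}} (hμ : ℵ₀ ≤ μ) {S : Set A} (hS : #S ≤ μ) : #(M.E S) ≤ μ := by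
  classical
  have hsub : M.E S ⊆ ⋃ F : Finset S, M.E ((↑) '' (F : Set S)) := by
    intro b hb
    obtain ⟨F, hF, hFS, hbF⟩ := M.fin hb
    lift F to Finset A using hF
    refine mem_iUnion.2 ⟨F.subtype (· ∈ S), M.mono ?_ hbF⟩
    intro x hx
    exact ⟨⟨x, hFS hx⟩, by simpa using hx, rfl⟩
  refine (mk_le_mk_of_subset hsub).trans (mk_iUnion_le_of hμ ?_ ?_)
  · rcases finite_or_infinite S with h | h
    · exact (mk_le_aleph0).trans hμ
    · rw [mk_finset_of_infinite]; exact hS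
  · intro F
    exact (M.ctb ((F.finite_toSet).image _)).le_aleph0.trans hμ

theorem good_exists {lam μ : Cardinal.{u}} (hμ : ℵ₀ ≤ μ) (hlam : Order.succ μ < lam) (X₀ : Set A)
    (H : ∀ S : Set A, X₀ ⊆ S → #S < lam → ∃ f, Match M S f) (X : Set A) (hX₀ : X₀ ⊆ X)
    (hX : #X ≤ μ) : ∃ S, X ⊆ S ∧ Good M μ S := by
  classical
  by_contra hcon
  push Not at hcon
  have h1 : ∀ S : Set A, ∃ (r : Ordinal.{u}) (T : Set A), #T ≤ μ ∧
      (X ⊆ S → #S ≤ μ → Bad M μ r S ∧ (∀ o, Bad M μ o S → r ≤ o) ∧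
        ∀ T' : Set A, #T' ≤ μ → S ⊆ T' → T ⊆ T' → Ext M S T' → ∃ o < r, Bad M μ o T') := by
    intro S
    by_cases h : X ⊆ S ∧ #S ≤ μ
    · have h2 := hcon S h.1
      unfold Good at h2
      push Not at h2
      have h3 : {o | Bad M μ o S}.Nonempty := h2 h.2
      have h4 : Bad M μ (sInf {o | Bad M μ o S}) S := csInf_mem h3
      have h5 : ∀ o, Bad M μ o S → sInf {o | Bad M μ o S} ≤ o := fun o ho => csInf_le' ho
      generalize sInf {o | Bad M μ o S} = r at h4 h5
      have h6 := h4
      obtain ⟨_, _, T, ρ, hT, ha, hb⟩ := h6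
      exact ⟨r, T, hT, fun _ _ => ⟨h4, h5, fun T' a b c d => ⟨_, ha T' a b c d, hb T' a b c d⟩⟩⟩
    · exact ⟨0, ∅, by simp, fun a b => absurd ⟨a, b⟩ h⟩
  choose ρ T hT hρ using h1
  have hdesc : ∀ S, X ⊆ S → #S ≤ μ → ∀ T' : Set A, #T' ≤ μ → S ⊆ T' → T S ⊆ T' → Ext M S T' →
      ρ T' < ρ S := by
    intro S hXS hS T' hT' hST hTT hE
    obtain ⟨o, ho, hb⟩ := (hρ S hXS hS).2.2 T' hT' hST hTT hE
    exact ((hρ T' (hXS.trans hST) hT').2.1 o hb).trans_lt ho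
  -- the index order
  let W : Type u := (Order.succ μ).ord.ToType
  have hreg : (Order.succ μ).IsRegular := isRegular_succ hμ
  have hWcard : #W = Order.succ μ := mk_ord_toType _
  have hIio : ∀ w : W, #(Iio w) ≤ μ := fun w => Order.lt_succ_iff.1 (mk_Iio_toType_ord_lt w)
  have hbd : ∀ (I : Type u) (g : I → W), #I ≤ μ → ∃ w, ∀ i, g i < w := by
    intro I g hI
    by_contra hno
    push Not at hno
    have : IsCofinal (range g) := fun w => by
      obtain ⟨i, hi⟩ := hno w
      exact ⟨_, ⟨i, rfl⟩, hi⟩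
    have h2 := Order.cof_le this
    rw [Ordinal.cof_toType] at h2
    have h3 := hreg.2.trans h2
    exact absurd (h3.trans (mk_range_le.trans hI)) (not_le.2 (Order.lt_succ μ))
  -- the chain
  let S : W → Set A := WellFounded.fix (r := ((· < ·) : W → W → Prop)) wellFounded_lt
    (fun w S => X ∪ ⋃ v : Iio w, (S v.1 v.2 ∪ T (S v.1 v.2)))
  have hS : ∀ w, S w = X ∪ ⋃ v : Iio w, (S v.1 ∪ T (S v.1)) := fun w =>
    WellFounded.fix_eq (r := ((· < ·) : W → W → Prop)) wellFounded_lt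
      (fun w (S : (v : W) → v < w → Set A) => X ∪ ⋃ v : Iio w, (S v.1 v.2 ∪ T (S v.1 v.2))) w
  clear_value S
  have hXS : ∀ w, X ⊆ S w := fun w => by rw [hS w]; exact subset_union_left
  have hlt : ∀ v w, v < w → S v ∪ T (S v) ⊆ S w := by
    intro v w hvw
    rw [hS w]
    exact (subset_iUnion (fun v : Iio w => S v.1 ∪ T (S v.1)) ⟨v, hvw⟩).trans subset_union_right
  have hmono : ∀ v w, v ≤ w → S v ⊆ S w := by
    intro v w hvw
    rcases hvw.eq_or_lt with h | h
    · rw [h]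
    · exact subset_union_left.trans (hlt v w h)
  have hcard : ∀ w, #(S w) ≤ μ := by
    intro w
    induction w using WellFoundedLT.induction with
    | ind w ih =>
      rw [hS w]
      refine mk_union_le_of hμ hX (mk_iUnion_le_of hμ (hIio w) ?_)
      intro v
      exact mk_union_le_of hμ (ih v.1 v.2) (hT _)
  let U : Set A := ⋃ w, S w
  have hSU : ∀ w, S w ⊆ U := fun w => subset_iUnion S w
  have hWne : Nonempty W := by
    rw [← mk_ne_zero_iff, hWcard]; exact (hreg.pos).ne'
  have hU : #U ≤ Order.succ μ :=
    mk_iUnion_le_of (hμ.trans (Order.le_succ μ)) hWcard.le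
      (fun w => (hcard w).trans (Order.le_succ μ))
  obtain ⟨f, hfinj, hf⟩ := H U (hX₀.trans ((hXS hWne.some).trans (hSU _))) (hU.trans_lt hlam)
  -- small subsets of `U` are captured
  have hcap : ∀ (Y : Set A), Y ⊆ U → #Y ≤ μ → ∀ w, ∃ v, w < v ∧ Y ⊆ S v := by
    intro Y hYU hY w
    have : ∀ y : Y, ∃ v, y.1 ∈ S v := fun y => mem_iUnion.1 (hYU y.2)
    choose g hg using this
    obtain ⟨v, hv⟩ := hbd Y g hY
    refine ⟨max v (Classical.choose (hbd PUnit (fun _ => w) (by simpa using one_le_aleph0.trans hμ))), ?_, ?_⟩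
    · exact lt_max_of_lt_right
        (Classical.choose_spec (hbd PUnit (fun _ => w) (by simpa using one_le_aleph0.trans hμ)) PUnit.unit)
    · intro y hy
      exact hmono _ _ ((hv ⟨y, hy⟩).le.trans (le_max_left _ _)) (hg ⟨y, hy⟩)
  have hFex : ∀ a : A, ∃ F : Set A, F.Finite ∧ F ⊆ U ∧ (a ∈ U → f a ∈ M.E F) := by
    intro a
    by_cases ha : a ∈ U
    · obtain ⟨F, h1, h2, h3⟩ := M.fin (hf a ha).2
      exact ⟨F, h1, h2, fun _ => h3⟩
    · exact ⟨∅, finite_empty, empty_subset _, fun h => absurd h ha⟩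
  choose F hFfin hFU hFE using hFex
  have hstep : ∀ w, ∃ v, w < v ∧ (∀ a ∈ U, f a ∈ M.E (S w) → a ∈ S v) ∧
      (∀ a ∈ S w, f a ∈ M.E (S v)) := by
    intro w
    have hY1 : #{a | a ∈ U ∧ f a ∈ M.E (S w)} ≤ μ := by
      refine le_trans ?_ (mk_E_le M hμ (hcard w))
      refine mk_le_of_injective (f := fun a => ⟨f a.1, a.2.2⟩) ?_
      intro a b hab
      exact Subtype.ext (hfinj a.2.1 b.2.1 (congrArg Subtype.val hab))
    have hY2 : #(⋃ a : S w, F a.1) ≤ μ :=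
      mk_iUnion_le_of hμ (hcard w) (fun a => ((hFfin a.1).lt_aleph0).le.trans hμ)
    obtain ⟨v, hv, hYv⟩ := hcap ({a | a ∈ U ∧ f a ∈ M.E (S w)} ∪ ⋃ a : S w, F a.1)
      (union_subset (fun a ha => ha.1) (iUnion_subset fun a => hFU a.1))
      (mk_union_le_of hμ hY1 hY2) w
    refine ⟨v, hv, fun a ha hfa => hYv (Or.inl ⟨ha, hfa⟩), fun a ha => ?_⟩
    refine M.mono ?_ (hFE a (hSU w ha))
    exact (subset_iUnion (fun a : S w => F a.1) ⟨a, ha⟩).trans (subset_union_right.trans hYv)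
  choose nx hnx1 hnx2 hnx3 using hstep
  -- closed indices
  let C : Set W := {w | (∀ a ∈ U, f a ∈ M.E (S w) → a ∈ S w) ∧ ∀ a ∈ S w, f a ∈ M.E (S w)}
  have hC : ∀ w, ∃ v ∈ C, w < v := by
    intro w
    let β : ℕ → W := fun n => nx^[n] w
    have hβ : ∀ n, β (n+1) = nx (β n) := fun n => Function.iterate_succ_apply' nx n w
    obtain ⟨v₀, hv₀⟩ := hbd (ULift.{u} ℕ) (fun n => β n.down) (by simpa using hμ)
    have hne : {v : W | ∀ n, β n < v}.Nonempty := ⟨v₀, fun n => hv₀ ⟨n⟩⟩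
    obtain ⟨v, hv, hmin⟩ : ∃ v, (∀ n, β n < v) ∧ ∀ x < v, ∃ n, x ≤ β n := by
      refine ⟨wellFounded_lt.min _ hne, wellFounded_lt.min_mem _ hne, fun x hx => ?_⟩
      by_contra hno
      push Not at hno
      exact wellFounded_lt.not_lt_min _ (show x ∈ {v : W | ∀ n, β n < v} from hno) hx
    have hβm : Monotone β := monotone_nat_of_le_succ fun n => by rw [hβ]; exact (hnx1 _).le
    have hSv : ∀ a ∈ S v, ∃ n, a ∈ S (β n) := by
      intro a ha
      rw [hS v] at ha
      rcases ha with ha | ha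
      · exact ⟨0, hXS _ ha⟩
      · obtain ⟨x, hx⟩ := mem_iUnion.1 ha
        obtain ⟨n, hn⟩ := hmin x.1 x.2
        refine ⟨n+1, hlt x.1 _ (hn.trans_lt ?_) hx⟩
        rw [hβ]; exact hnx1 _
    refine ⟨v, ⟨fun a ha hfa => ?_, fun a ha => ?_⟩, hv 0⟩
    · obtain ⟨G, hG, hGS, hfG⟩ := M.fin hfa
      have : ∃ n, G ⊆ S (β n) := by
        have h1 : ∀ a : G, ∃ n, a.1 ∈ S (β n) := fun a => hSv a.1 (hGS a.2)
        choose k hk using h1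
        have := hG.to_subtype
        obtain ⟨n, hn⟩ := (finite_range k).bddAbove
        exact ⟨n, fun a ha => hmono _ _ (hβm (hn ⟨⟨a, ha⟩, rfl⟩)) (hk ⟨a, ha⟩)⟩
      obtain ⟨n, hn⟩ := this
      have h2 := hnx2 (β n) a ha (M.mono hn hfG)
      rw [← hβ] at h2
      exact hmono _ _ (hv _).le h2
    · obtain ⟨n, hn⟩ := hSv a ha
      have h2 := hnx3 (β n) a hn
      rw [← hβ] at h2
      exact M.mono (hmono _ _ (hv _).le) h2
  -- contradiction by descent
  have hCno : ∀ o : Ordinal.{u}, ∀ w ∈ C, ρ (S w) ≠ o := by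
    intro o
    induction o using WellFoundedLT.induction with
    | ind o ih =>
      rintro w hw rfl
      obtain ⟨v, hvC, hwv⟩ := hC w
      refine ih (ρ (S v)) ?_ v hvC rfl
      refine hdesc (S w) (hXS w) (hcard w) (S v) (hcard v) (hmono _ _ hwv.le)
        (subset_union_right.trans (hlt w v hwv)) ⟨f, ?_, ?_⟩
      · exact hfinj.mono (sdiff_subset.trans (hSU v))
      · intro a ha
        exact ⟨(hf a (hSU v ha.1)).1, hvC.2 a ha.1, fun h => ha.2 (hw.1 a (hSU v ha.1) h)⟩
  obtain ⟨v, hv, -⟩ := hC hWne.some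
  exact hCno _ v hv rfl

theorem Match.extend {S T : Set A} {f : A → B} (hf : Match M S f) (hST : S ⊆ T) (hE : Ext M S T) :
    ∃ f', Match M T f' ∧ ∀ a ∈ S, f' a = f a := by
  classical
  obtain ⟨g, hg, hg'⟩ := hE
  refine ⟨fun a => if a ∈ S then f a else g a, ⟨?_, ?_⟩, fun a ha => by simp [ha]⟩
  · intro a ha b hb hab
    by_cases h1 : a ∈ S <;> by_cases h2 : b ∈ S <;> simp only [h1, h2, if_true, if_false] at hab
    · exact hf.1 h1 h2 hab
    · exact absurd (hab ▸ (hf.2 a h1).2) (hg' b ⟨hb, h2⟩).2.2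
    · exact absurd (hab ▸ (hf.2 b h2).2) (hg' a ⟨ha, h1⟩).2.2
    · exact hg ⟨ha, h1⟩ ⟨hb, h2⟩ hab
  · intro a ha
    by_cases h1 : a ∈ S <;> simp only [h1, if_true, if_false]
    · exact ⟨(hf.2 a h1).1, M.mono hST (hf.2 a h1).2⟩
    · exact ⟨(hg' a ⟨ha, h1⟩).1, (hg' a ⟨ha, h1⟩).2.1⟩

theorem compactness {lam : Cardinal.{u}} (X₀ : Set A) (hX₀ : X₀.Finite)
    (H : ∀ S : Set A, X₀ ⊆ S → #S < lam → ∃ f, Match M S f)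
    (ι : Type u) [Nonempty ι] (c : ι → Cardinal.{u}) (hc : ∀ i, ℵ₀ ≤ c i) (hι : ∀ i, #ι ≤ c i)
    (hcl : ∀ i, Order.succ (c i) < lam) (Y : ι → Set A) (hY : ∀ i, #(Y i) ≤ c i)
    (hYU : ∀ a, ∃ i, a ∈ Y i) :
    ∃ F : A → B, Function.Injective F ∧ ∀ a, M.Adj a (F a) := by
  classical
  let St := {p : (ι → Set A) × (ι → A → B) // ∀ i, Good M (c i) (p.1 i) ∧ Match M (p.1 i) (p.2 i)}
  have hinit : ∃ p : St, ∀ i, Y i ⊆ p.1.1 i := by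
    have h1 : ∀ i, ∃ S, Y i ∪ X₀ ⊆ S ∧ Good M (c i) S := fun i =>
      good_exists M (hc i) (hcl i) X₀ H _ subset_union_right
        (mk_union_le_of (hc i) (hY i) (hX₀.lt_aleph0.le.trans (hc i)))
    choose S hS hG using h1
    have h2 : ∀ i, ∃ f, Match M (S i) f := fun i =>
      H _ (subset_union_right.trans (hS i))
        ((hG i).1.trans_lt ((Order.lt_succ _).trans (hcl i)))
    choose f hf using h2
    exact ⟨⟨(S, f), fun i => ⟨hG i, hf i⟩⟩, fun i => subset_union_left.trans (hS i)⟩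
  have hstep : ∀ p : St, ∃ q : St, (∀ i, p.1.1 i ⊆ q.1.1 i) ∧
      (∀ i, ∀ a ∈ p.1.1 i, q.1.2 i a = p.1.2 i a) ∧
      (∀ i j, c j ≤ c i → p.1.1 j ⊆ q.1.1 i) ∧
      (∀ i j, ∀ a ∈ p.1.1 j, p.1.2 j a ∈ M.E (p.1.1 i) → a ∈ q.1.1 i) := by
    rintro ⟨⟨S, f⟩, hp⟩
    simp only at hp
    have hG : ∀ i, Good M (c i) (S i) := fun i => (hp i).1
    have hf : ∀ i, Match M (S i) (f i) := fun i => (hp i).2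
    have h1 : ∀ i, ∃ T', S i ⊆ T' ∧
        ((⋃ j : {j // c j ≤ c i}, S j.1) ∪ ⋃ j, {a | a ∈ S j ∧ f j a ∈ M.E (S i)}) ⊆ T' ∧
        Ext M (S i) T' ∧ Good M (c i) T' := by
      intro i
      refine (hG i).step M _ (mk_union_le_of (hc i) ?_ ?_)
      · exact mk_iUnion_le_of (hc i) ((mk_subtype_le _).trans (hι i))
          (fun j => (hG j.1).1.trans j.2)
      · refine mk_iUnion_le_of (hc i) (hι i) (fun j => ?_)
        refine le_trans ?_ (mk_E_le M (hc i) (hG i).1)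
        refine mk_le_of_injective (f := fun a => ⟨f j a.1, a.2.2⟩) ?_
        intro a b hab
        exact Subtype.ext ((hf j).1 a.2.1 b.2.1 (congrArg Subtype.val hab))
    choose S' hSS' hTS' hE hG' using h1
    have h2 : ∀ i, ∃ f', Match M (S' i) f' ∧ ∀ a ∈ S i, f' a = f i a := fun i =>
      (hf i).extend M (hSS' i) (hE i)
    choose f' hf' hff' using h2
    refine ⟨⟨(S', f'), fun i => ⟨hG' i, hf' i⟩⟩, hSS', hff', ?_, ?_⟩
    · intro i j hij
      exact (subset_iUnion (fun j : {j // c j ≤ c i} => S j.1) ⟨j, hij⟩).trans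
        (subset_union_left.trans (hTS' i))
    · intro i j a ha hfa
      exact hTS' i (Or.inr (mem_iUnion.2 ⟨j, ha, hfa⟩))
  obtain ⟨p₀, hp₀⟩ := hinit
  choose nx h1 h2 h3 h4 using hstep
  let P : ℕ → St := fun n => nx^[n] p₀
  have hP : ∀ n, P (n+1) = nx (P n) := fun n => Function.iterate_succ_apply' nx n p₀
  let s : ℕ → ι → Set A := fun n => (P n).1.1
  let g : ℕ → ι → A → B := fun n => (P n).1.2
  have hsm : ∀ i, Monotone (fun n => s n i) := fun i => monotone_nat_of_le_succ fun n => by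
    change (P n).1.1 i ⊆ (P (n+1)).1.1 i
    rw [hP]; exact h1 _ i
  have hgs : ∀ i n a, a ∈ s n i → g (n+1) i a = g n i a := fun i n a ha => by
    change (P (n+1)).1.2 i a = (P n).1.2 i a
    rw [hP]; exact h2 _ i a ha
  have hgm : ∀ i n m a, n ≤ m → a ∈ s n i → g m i a = g n i a := by
    intro i n m a hnm ha
    induction m, hnm using Nat.le_induction with
    | base => rfl
    | succ m hm ih => rw [hgs i m a (hsm i hm ha), ih]
  have hs3 : ∀ n i j, c j ≤ c i → s n j ⊆ s (n+1) i := fun n i j hij => by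
    change (P n).1.1 j ⊆ (P (n+1)).1.1 i
    rw [hP]; exact h3 _ i j hij
  have hs4 : ∀ n i j, ∀ a ∈ s n j, g n j a ∈ M.E (s n i) → a ∈ s (n+1) i := fun n i j a ha hg => by
    change a ∈ (P (n+1)).1.1 i
    rw [hP]; exact h4 _ i j a ha hg
  have hMatch : ∀ n i, Match M (s n i) (g n i) := fun n i => ((P n).2 i).2
  have hsY : ∀ i, Y i ⊆ s 0 i := hp₀
  clear_value s g
  let S : ι → Set A := fun i => ⋃ n, s n i
  have hmemS : ∀ {i a}, a ∈ S i ↔ ∃ n, a ∈ s n i := fun {i a} => mem_iUnion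
  let f : ι → A → B := fun i a => if h : ∃ n, a ∈ s n i then g (Nat.find h) i a else g 0 i a
  have hfg : ∀ i n a, a ∈ s n i → f i a = g n i a := by
    intro i n a ha
    have h : ∃ n, a ∈ s n i := ⟨n, ha⟩
    simp only [f, dif_pos h]
    exact (hgm i _ n a (Nat.find_min' h ha) (Nat.find_spec h)).symm
  have hL1 : ∀ i j, c j ≤ c i → S j ⊆ S i := by
    intro i j hij a ha
    obtain ⟨n, hn⟩ := hmemS.1 ha
    exact hmemS.2 ⟨n+1, hs3 n i j hij hn⟩
  have hL2 : ∀ i j, ∀ a ∈ S j, f j a ∈ M.E (S i) → a ∈ S i := by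
    intro i j a ha hfa
    obtain ⟨n, hn⟩ := hmemS.1 ha
    obtain ⟨G, hG, hGS, hfG⟩ := M.fin hfa
    have : ∃ n, G ⊆ s n i := by
      have h1 : ∀ a : G, ∃ n, a.1 ∈ s n i := fun a => hmemS.1 (hGS a.2)
      choose k hk using h1
      have := hG.to_subtype
      obtain ⟨n, hn⟩ := (finite_range k).bddAbove
      exact ⟨n, fun a ha => hsm i (hn ⟨⟨a, ha⟩, rfl⟩) (hk ⟨a, ha⟩)⟩
    obtain ⟨m, hm⟩ := this
    have ha' : a ∈ s (max n m) j := hsm j (le_max_left n m) hn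
    refine hmemS.2 ⟨max n m + 1, hs4 _ i j a ha' ?_⟩
    rw [← hfg j _ a ha']
    exact M.mono (hm.trans (hsm i (le_max_right n m))) hfG
  have hL3 : ∀ i, Match M (S i) (f i) := by
    intro i
    refine ⟨?_, ?_⟩
    · intro a ha b hb hab
      obtain ⟨n, hn⟩ := hmemS.1 ha
      obtain ⟨m, hm⟩ := hmemS.1 hb
      have ha' : a ∈ s (max n m) i := hsm i (le_max_left n m) hn
      have hb' : b ∈ s (max n m) i := hsm i (le_max_right n m) hm
      rw [hfg i _ a ha', hfg i _ b hb'] at hab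
      exact (hMatch _ i).1 ha' hb' hab
    · intro a ha
      obtain ⟨n, hn⟩ := hmemS.1 ha
      rw [hfg i n a hn]
      exact ⟨((hMatch n i).2 a hn).1, M.mono (subset_iUnion (fun n => s n i) n) ((hMatch n i).2 a hn).2⟩
  have hL4 : ∀ a, ∃ i, a ∈ S i := fun a => by
    obtain ⟨i, hi⟩ := hYU a
    exact ⟨i, hmemS.2 ⟨0, hsY i hi⟩⟩
  clear_value S f
  -- minimal level
  have hν : ∀ a, ∃ ν : Cardinal.{u}, (∃ i, a ∈ S i ∧ c i = ν) ∧ ∀ i, a ∈ S i → ν ≤ c i := by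
    intro a
    obtain ⟨i₀, hi₀⟩ := hL4 a
    have hne : {ν | ∃ i, a ∈ S i ∧ c i = ν}.Nonempty := ⟨_, i₀, hi₀, rfl⟩
    exact ⟨sInf {ν | ∃ i, a ∈ S i ∧ c i = ν}, csInf_mem hne, fun i hi => csInf_le' ⟨i, hi, rfl⟩⟩
  choose ν hν1 hν2 using hν
  have hrep : ∀ κ : Cardinal.{u}, ∃ i, (∃ j, c j = κ) → c i = κ := by
    intro κ
    by_cases h : ∃ j, c j = κ
    · obtain ⟨j, hj⟩ := h
      exact ⟨j, fun _ => hj⟩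
    · exact ⟨Classical.arbitrary ι, fun h' => absurd h' h⟩
  choose rep hrep using hrep
  have hrc : ∀ a, c (rep (ν a)) = ν a := fun a => by
    obtain ⟨i, -, hi⟩ := hν1 a
    exact hrep _ ⟨i, hi⟩
  have hrS : ∀ a, a ∈ S (rep (ν a)) := fun a => by
    obtain ⟨i, hi, hci⟩ := hν1 a
    exact hL1 _ i (by rw [hrc, hci]) hi
  have key : ∀ a b, f (rep (ν a)) a = f (rep (ν b)) b → ν b ≤ ν a := by
    intro a b hab
    have h5 := ((hL3 _).2 a (hrS a)).2
    rw [hab] at h5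
    have h6 := hν2 b _ (hL2 _ _ b (hrS b) h5)
    rwa [hrc] at h6
  refine ⟨fun a => f (rep (ν a)) a, ?_, fun a => ((hL3 _).2 a (hrS a)).1⟩
  intro a b hab
  have hab' : f (rep (ν a)) a = f (rep (ν b)) b := hab
  have h5 : ν a = ν b := le_antisymm (key b a hab'.symm) (key a b hab')
  have hb := hrS b
  rw [← h5] at hab' hb
  exact (hL3 _).1 (hrS a) hb hab'

theorem compactness_singular {lam : Cardinal.{u}} (hinf : ℵ₀ ≤ lam) (hsing : ¬ lam.IsRegular)
    (hA : #A ≤ lam) (X₀ : Set A) (hX₀ : X₀.Finite)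
    (H : ∀ S : Set A, X₀ ⊆ S → #S < lam → ∃ f, Match M S f) :
    ∃ F : A → B, Function.Injective F ∧ ∀ a, M.Adj a (F a) := by
  have hcof : lam.ord.cof < lam := by
    by_contra h
    exact hsing ⟨hinf, not_lt.1 h⟩
  have hlim : ∀ μ, ℵ₀ ≤ μ → μ < lam → Order.succ μ < lam := by
    intro μ hμ hlt
    refine lt_of_le_of_ne (Order.succ_le_of_lt hlt) ?_
    rintro rfl
    exact hsing (isRegular_succ hμ)
  have hunc : ℵ₀ < lam := by
    refine lt_of_le_of_ne hinf ?_
    rintro rfl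
    exact hsing isRegular_aleph0
  let W : Type u := lam.ord.ToType
  have hW : #W = lam := mk_ord_toType _
  have hWne : Nonempty W := by
    rw [← mk_ne_zero_iff, hW]; exact (aleph0_pos.trans_le hinf).ne'
  obtain ⟨s, hs, hscard⟩ := Order.exists_cof_eq W
  have hsc : #s < lam := by rw [hscard, Ordinal.cof_toType]; exact hcof
  obtain ⟨e⟩ : Nonempty (A ↪ W) := by rw [← Cardinal.le_def, hW]; exact hA
  obtain ⟨w₀, hw₀, -⟩ := hs hWne.some
  have : Nonempty s := ⟨⟨w₀, hw₀⟩⟩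
  have hlt : ∀ i : s, #(Iio i.1) < lam := fun i => mk_Iio_toType_ord_lt i.1
  refine compactness M X₀ hX₀ H s (fun i => max (#(Iio i.1)) (max (#s) ℵ₀))
    (fun i => (le_max_right _ _).trans (le_max_right _ _))
    (fun i => (le_max_left _ _).trans (le_max_right _ _))
    (fun i => hlim _ ((le_max_right _ _).trans (le_max_right _ _))
      (max_lt (hlt i) (max_lt hsc hunc)))
    (fun i => {a | e a < i.1} ∪ {a | e a = i.1}) (fun i => ?_) (fun a => ?_)
  · refine mk_union_le_of ((le_max_right _ _).trans (le_max_right _ _)) ?_ ?_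
    · refine le_trans ?_ (le_max_left _ _)
      refine mk_le_of_injective (f := fun a => ⟨e a.1, a.2⟩) ?_
      intro a b hab
      exact Subtype.ext (e.injective (congrArg Subtype.val hab))
    · refine le_trans ?_ ((le_max_right _ _).trans (le_max_right _ _))
      have : Set.Subsingleton {a | e a = i.1} := fun a ha b hb => e.injective (ha.trans hb.symm)
      exact this.finite.lt_aleph0.le
  · obtain ⟨x, hx, hax⟩ := hs (e a)
    exact ⟨⟨x, hx⟩, hax.lt_or_eq⟩

end SingStep

namespace SingStep
open Cardinal Set

section Lattice
variable {L : Type u} [CompleteLattice L]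

/-- `x` is the join of the atoms of `S` below it. -/
def Spn (S : Set {a : L // IsAtom a}) (x : L) : Prop :=
  ∀ y, (∀ a ∈ S, a.1 ≤ x → a.1 ≤ y) → x ≤ y

theorem Spn.mono {S T : Set {a : L // IsAtom a}} (h : S ⊆ T) {x : L} (hx : Spn S x) : Spn T x :=
  fun y hy => hx y fun a ha => hy a (h ha)

theorem spn_sSup {S : Set {a : L // IsAtom a}} {s : Set L} (hs : ∀ x ∈ s, Spn S x) :
    Spn S (sSup s) := fun y hy =>
  sSup_le fun x hx => hs x hx y fun a ha hax => hy a ha (hax.trans (le_sSup hx))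

theorem spn_bot (S : Set {a : L // IsAtom a}) : Spn S (⊥ : L) := fun _ _ => bot_le

theorem spn_atom {S : Set {a : L // IsAtom a}} {a : {a : L // IsAtom a}} (ha : a ∈ S) :
    Spn S a.1 := fun _ hy => hy a ha le_rfl

theorem Spn.sup {S : Set {a : L // IsAtom a}} {x y : L} (hx : Spn S x) (hy : Spn S y) :
    Spn S (x ⊔ y) := fun z hz =>
  sup_le (hx z fun a ha h => hz a ha (h.trans le_sup_left))
    (hy z fun a ha h => hz a ha (h.trans le_sup_right))

theorem Spn.exists_atom {S : Set {a : L // IsAtom a}} {x y : L} (hy : Spn S y) (hxy : ¬ y ≤ x) :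
    ∃ a ∈ S, a.1 ≤ y ∧ ¬ a.1 ≤ x := by
  by_contra h
  push Not at h
  exact hxy (hy x h)

theorem wf_gt (hch : ∀ c : Set L, IsChain (· ≤ ·) c → c.Finite) : WellFoundedGT L := by
  rw [wellFoundedGT_iff_monotone_chain_condition']
  intro f
  by_contra hcon
  push Not at hcon
  have hfin := hch (range f) (by
    rintro _ ⟨i, rfl⟩ _ ⟨j, rfl⟩ _
    rcases le_total i j with h | h
    · exact Or.inl (f.monotone h)
    · exact Or.inr (f.monotone h))
  obtain ⟨m, ⟨n, rfl⟩, hm⟩ := hfin.exists_maximal (range_nonempty f)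
  obtain ⟨k, hk, hlt⟩ := hcon n
  exact absurd (hm ⟨k, rfl⟩ hlt.le) hlt.not_ge

theorem wf_lt (hch : ∀ c : Set L, IsChain (· ≤ ·) c → c.Finite) : WellFoundedLT L := by
  have : WellFoundedGT Lᵒᵈ := wf_gt (L := Lᵒᵈ) (fun c hc => hch c hc.symm)
  exact ⟨this.1⟩

theorem Spn.finite [WellFoundedGT L] {S : Set {a : L // IsAtom a}} {x : L} (hx : Spn S x) :
    ∃ F : Set {a : L // IsAtom a}, F.Finite ∧ F ⊆ S ∧ Spn F x := by
  classical
  obtain ⟨t, ht, hsup⟩ := CompleteLattice.WellFoundedGT.isSupFiniteCompact L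
    ((↑) '' {a : {a : L // IsAtom a} | a ∈ S ∧ a.1 ≤ x})
  refine ⟨Subtype.val ⁻¹' (t : Set L), t.finite_toSet.preimage Subtype.val_injective.injOn, ?_, ?_⟩
  · intro a ha
    obtain ⟨b, hb, hba⟩ := ht ha
    rw [Subtype.ext hba] at hb
    exact hb.1
  · intro y hy
    have h1 : x ≤ t.sup id := by
      rw [← hsup]
      exact hx _ fun a ha hax => le_sSup ⟨a, ⟨ha, hax⟩, rfl⟩
    refine h1.trans (Finset.sup_le fun z hz => ?_)
    obtain ⟨b, hb, rfl⟩ := ht hz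
    exact hy b hz hb.2

/-- The system attached to a lattice. -/
def sys (L : Type u) [CompleteLattice L] [WellFoundedGT L] : Sys {a : L // IsAtom a} L where
  Adj a h := a.1 ≤ h ∧ IsCoatom h
  E S := {x | Spn S x}
  mono h _ hx := Spn.mono h hx
  fin h := Spn.finite h
  ctb {F} hF := by
    refine Set.Finite.countable ?_
    refine Set.Finite.of_injOn (f := fun x => {a | a ∈ F ∧ a.1 ≤ x}) (t := 𝒫 F) ?_ ?_
      hF.finite_subsets
    · intro x _ a ha
      exact ha.1
    · intro x hx y hy hxy
      have hxy' : ∀ a, (a ∈ F ∧ a.1 ≤ x) ↔ (a ∈ F ∧ a.1 ≤ y) := fun a => Set.ext_iff.1 hxy a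
      exact le_antisymm (hx y fun a ha h => ((hxy' a).1 ⟨ha, h⟩).2)
        (hy x fun a ha h => ((hxy' a).2 ⟨ha, h⟩).2)

theorem covBy_sup_atom (hL : IsGeomLatFH L) {a : L} (ha : IsAtom a) (x : L) (hax : ¬ a ≤ x) :
    x ⋖ x ⊔ a := by
  obtain ⟨-, -, hch, hsm, -⟩ := hL
  have := wf_lt hch
  have := wf_gt hch
  induction x using WellFoundedLT.induction with
  | ind x ih =>
    rcases eq_or_ne x ⊥ with rfl | hx
    · rw [bot_sup_eq]; exact ha.bot_covBy
    · -- a lower cover of `x`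
      obtain ⟨y, hy⟩ : ∃ y, y ⋖ x := by
        obtain ⟨y, hy, hmax⟩ := (wellFounded_gt (α := L)).has_min {y | y < x}
          ⟨⊥, bot_lt_iff_ne_bot.2 hx⟩
        exact ⟨y, hy, fun z hz hzx => hmax z hzx hz⟩
      have hay : ¬ a ≤ y := fun h => hax (h.trans hy.le)
      have h1 := ih y hy.lt hay
      obtain ⟨d, hd1, hd2⟩ := hsm y x (y ⊔ a) hy h1 (fun h => hax (h ▸ le_sup_right))
      have h2 : x ⊔ a ≤ d := sup_le hd1.le (le_sup_right.trans hd2.le)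
      have h3 : x < x ⊔ a := left_lt_sup.2 hax
      have h4 : x ⊔ a = d := by
        by_contra hne
        exact hd1.2 h3 (lt_of_le_of_ne h2 hne)
      rwa [h4]

/-- The sublattice spanned by `S`. -/
abbrev Sub (S : Set {a : L // IsAtom a}) : Type u := {x : L // Spn S x}

noncomputable instance subLat (S : Set {a : L // IsAtom a}) : CompleteLattice (Sub S) :=
  letI : SupSet (Sub S) := ⟨fun s => ⟨sSup (Subtype.val '' s), spn_sSup (by
    rintro _ ⟨x, -, rfl⟩; exact x.2)⟩⟩
  completeLatticeOfSup (Sub S) (by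
    intro s
    refine ⟨fun x hx => ?_, fun y hy => ?_⟩
    · exact le_sSup (α := L) ⟨x, hx, rfl⟩
    · refine sSup_le (α := L) ?_
      rintro _ ⟨x, hx, rfl⟩
      exact hy hx)

theorem sub_covBy (hL : IsGeomLatFH L) {S : Set {a : L // IsAtom a}} {x y : Sub S} (h : x ⋖ y) :
    x.1 ⋖ y.1 ∧ ∃ a ∈ S, ¬ a.1 ≤ x.1 ∧ y.1 = x.1 ⊔ a.1 := by
  have hlt : x.1 < y.1 := h.lt
  obtain ⟨a, haS, hay, hax⟩ := y.2.exists_atom hlt.not_ge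
  have h1 := covBy_sup_atom hL a.2 x.1 hax
  have h2 : y.1 = x.1 ⊔ a.1 := by
    by_contra hne
    have h3 : x.1 ⊔ a.1 ≤ y.1 := sup_le hlt.le hay
    exact h.2 (c := ⟨x.1 ⊔ a.1, x.2.sup (spn_atom haS)⟩) h1.lt
      (show x.1 ⊔ a.1 < y.1 from lt_of_le_of_ne h3 (Ne.symm hne))
  exact ⟨h2 ▸ h1, a, haS, hax, h2⟩

theorem covBy_sub {S : Set {a : L // IsAtom a}} {x y : Sub S} (h : x.1 ⋖ y.1) : x ⋖ y :=
  ⟨h.lt, fun _ h1 h2 => h.2 h1 h2⟩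

theorem sub_bot (S : Set {a : L // IsAtom a}) : (⊥ : Sub S).1 = ⊥ :=
  le_bot_iff.1 (show (⊥ : Sub S) ≤ ⟨⊥, spn_bot S⟩ from bot_le)

theorem sub_top {S : Set {a : L // IsAtom a}} (h : Spn S (⊤ : L)) : (⊤ : Sub S).1 = ⊤ :=
  top_le_iff.1 (show (⟨⊤, h⟩ : Sub S) ≤ ⊤ from le_top)

theorem sub_atom {S : Set {a : L // IsAtom a}} {a : {a : L // IsAtom a}} (ha : a ∈ S) :
    IsAtom (⟨a.1, spn_atom ha⟩ : Sub S) := by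
  rw [← bot_covBy_iff]
  apply covBy_sub
  rw [sub_bot]
  exact a.2.bot_covBy

theorem sub_geom (hL : IsGeomLatFH L) (S : Set {a : L // IsAtom a}) : IsGeomLatFH (Sub S) := by
  refine ⟨fun x y => ⟨x ⊔ y, isLUB_pair⟩, fun x y => ⟨x ⊓ y, isGLB_pair⟩, ?_, ?_, ?_⟩
  · intro c hc
    refine Set.Finite.of_finite_image (f := Subtype.val) (hL.2.2.1 _ ?_)
      Subtype.val_injective.injOn
    rintro _ ⟨x, hx, rfl⟩ _ ⟨y, hy, rfl⟩ hne
    exact hc hx hy (fun h => hne (congrArg _ h))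
  · intro a b c hab hac hbc
    obtain ⟨hab', p, hp, hpa, hb⟩ := sub_covBy hL hab
    obtain ⟨hac', q, hq, hqa, hc⟩ := sub_covBy hL hac
    have hne : b.1 ≠ c.1 := fun h => hbc (Subtype.ext h)
    have hqb : ¬ q.1 ≤ b.1 := by
      intro h
      have h1 : c.1 ≤ b.1 := by rw [hc]; exact sup_le hab'.le h
      exact hab'.2 hac'.lt (lt_of_le_of_ne h1 hne.symm)
    have hpc : ¬ p.1 ≤ c.1 := by
      intro h
      have h1 : b.1 ≤ c.1 := by rw [hb]; exact sup_le hac'.le h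
      exact hac'.2 hab'.lt (lt_of_le_of_ne h1 hne)
    refine ⟨⟨b.1 ⊔ q.1, b.2.sup (spn_atom hq)⟩, covBy_sub (covBy_sup_atom hL q.2 _ hqb), covBy_sub ?_⟩
    have h2 : b.1 ⊔ q.1 = c.1 ⊔ p.1 := by
      rw [hb, hc, sup_right_comm]
    change c.1 ⋖ b.1 ⊔ q.1
    rw [h2]
    exact covBy_sup_atom hL p.2 _ hpc
  · intro x
    refine ⟨{z | ∃ a, ∃ h : a ∈ S, a.1 ≤ x.1 ∧ z = ⟨a.1, spn_atom h⟩}, ?_, ?_, ?_⟩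
    · rintro _ ⟨a, h, -, rfl⟩
      exact ⟨⊥, fun _ => bot_le, (sub_atom h).bot_covBy⟩
    · rintro _ ⟨a, h, hax, rfl⟩
      exact hax
    · intro y hy
      exact x.2 y.1 fun a ha hax => hy ⟨a, ha, hax, rfl⟩

theorem spn_top (hL : IsGeomLatFH L) (x : L) : Spn univ x := by
  obtain ⟨T, hT, hlub⟩ := hL.2.2.2.2 x
  intro y hy
  refine hlub.2 fun t ht => ?_
  obtain ⟨z, hz, hzt⟩ := hT t ht
  have hz' : z = ⊥ := le_bot_iff.1 (hz ⊥)
  subst hz'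
  exact hy ⟨t, bot_covBy_iff.1 hzt⟩ (mem_univ _) (hlub.1 ht)

end Lattice
end SingStep

/-- If `λ` is a singular cardinal and every geometric lattice of finite rank at least 2
and cardinality `< λ` has a matching, then every geometric lattice of finite rank at
least 2 and cardinality `λ` has a matching. -/
theorem singular_step_matching (lam : Cardinal.{u})
    (hinf : Cardinal.aleph0 ≤ lam) (hsing : ¬ lam.IsRegular)
    (H : ∀ (L' : Type u) [CompleteLattice L'] (r' : L' → ℕ),
      IsGeomLatFH L' → IsRankFn r' → 2 ≤ r' ⊤ → Cardinal.mk L' < lam → HasMatching L')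
    (L : Type u) [CompleteLattice L] (r : L → ℕ)
    (hL : IsGeomLatFH L) (hr : IsRankFn r) (hrank : 2 ≤ r ⊤)
    (hcard : Cardinal.mk L = lam) :
    HasMatching L := by
  have hgt : WellFoundedGT L := SingStep.wf_gt hL.2.2.1
  have hunc : Cardinal.aleph0 < lam := by
    refine lt_of_le_of_ne hinf ?_
    rintro rfl
    exact hsing Cardinal.isRegular_aleph0
  obtain ⟨X₀, hX₀, -, hX₀t⟩ := (SingStep.spn_top hL (⊤ : L)).finite
  obtain ⟨F, hFinj, hF⟩ := SingStep.compactness_singular (SingStep.sys L) hinf hsing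
    (hcard ▸ Cardinal.mk_subtype_le _) X₀ hX₀ (by
      intro S hXS hS
      have htop := SingStep.sub_top (hX₀t.mono hXS)
      have hc : Cardinal.mk (SingStep.Sub S) < lam :=
        (SingStep.mk_E_le (SingStep.sys L) (le_max_right (Cardinal.mk S) Cardinal.aleph0)
          (le_max_left _ _)).trans_lt (max_lt hS hunc)
      obtain ⟨f, hfinj, hf⟩ := H (SingStep.Sub S) (fun x => r x.1) (SingStep.sub_geom hL S)
        ⟨by
            change r (⊥ : SingStep.Sub S).1 = 0
            rw [SingStep.sub_bot]; exact hr.1,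
          fun x y hxy => hr.2 _ _ (SingStep.sub_covBy hL hxy).1⟩
        (by rw [htop]; exact hrank) hc
      classical
      refine ⟨fun a => if h : a ∈ S then (f ⟨_, SingStep.sub_atom h⟩).1.1 else ⊤, ?_, ?_⟩
      · intro a ha b hb hab
        simp only [dif_pos ha, dif_pos hb] at hab
        have h1 := hfinj (Subtype.ext (Subtype.ext hab))
        exact Subtype.ext (congrArg (fun z => z.1.1) h1)
      · intro a ha
        simp only [dif_pos ha]
        have hco := (SingStep.sub_covBy hL (f ⟨_, SingStep.sub_atom ha⟩).2.covBy_top).1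
        rw [htop] at hco
        exact ⟨⟨hf ⟨_, SingStep.sub_atom ha⟩, covBy_top_iff.1 hco⟩,
          (f ⟨_, SingStep.sub_atom ha⟩).1.2⟩)
  exact ⟨fun a => ⟨F a, (hF a).2⟩, fun a b hab => hFinj (congrArg Subtype.val hab),
    fun a => (hF a).1⟩
end

section
/- Every geometric lattice of finite rank greater than 1 has a matching: there is an injective map f from the set of atoms of L to the set of hyperplanes of L with a ≤ f(a) for every atom a. -/
universe u

namespace GeomMatch

/-- Greedy transversal. -/
theorem greedy {ι β : Type u} (T : ι → Set β) (hT : ∀ i, Cardinal.mk ι ≤ Cardinal.mk (T i)) :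
    ∃ g : ι → β, Function.Injective g ∧ ∀ i, g i ∈ T i := by
  classical
  obtain ⟨r, wo, hr⟩ := Cardinal.exists_ord_eq ι
  have key : ∀ i (F : (j : ι) → r j i → β), ∃ b ∈ T i, ∀ j (h : r j i), F j h ≠ b := by
    intro i F
    by_contra hcon
    push Not at hcon
    have h1 : T i ⊆ Set.range (fun j : {j // r j i} => F j.1 j.2) := by
      intro b hb
      obtain ⟨j, h, e⟩ := hcon b hb
      exact ⟨⟨j, h⟩, e⟩
    have h2 := (Cardinal.mk_le_mk_of_subset h1).trans Cardinal.mk_range_le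
    have h3 : Cardinal.mk {j // r j i} < Cardinal.mk ι := by
      have := Cardinal.card_typein_lt i hr.symm.symm
      simpa using this
    exact absurd ((hT i).trans h2) (not_le.mpr h3)
  choose G hG1 hG2 using key
  let g : ι → β := wo.wf.fix (fun i F => G i F)
  have hg : ∀ i, g i = G i (fun j _ => g j) := fun i => wo.wf.fix_eq _ i
  refine ⟨g, ?_, fun i => by rw [hg]; exact hG1 _ _⟩
  intro i j hij
  rcases trichotomous_of r i j with h | h | h
  · exfalso
    have := hG2 j (fun k _ => g k) i h
    rw [← hg] at this
    exact this hij
  · exact h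
  · exfalso
    have := hG2 i (fun k _ => g k) j h
    rw [← hg] at this
    exact this hij.symm

theorem hall_conway {ι β : Type u} [Fintype ι] [DecidableEq β] (t : ι → Finset β)
    (D : ∀ i j h, h ∈ t j → h ∉ t i → (Finset.univ.filter (fun k => h ∈ t k)).card ≤ (t i).card)
    (sep : ∀ i j, i ≠ j → ∃ h ∈ t j, h ∉ t i) (ne : ∀ i, (t i).Nonempty)
    (X : ∀ S : Finset ι, 2 ≤ S.card → (∃ h, ∀ i ∈ S, h ∈ t i) → S.card ≤ (S.biUnion t).card) :
    ∃ f : ι → β, Function.Injective f ∧ ∀ i, f i ∈ t i := by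
  classical
  rw [← Finset.all_card_le_biUnion_card_iff_exists_injective]
  intro S
  by_contra hlt
  push Not at hlt
  set N := S.biUnion t with hN
  have hS : S.Nonempty := by
    rw [← Finset.card_pos]; omega
  have hsub : ∀ i ∈ S, t i ⊆ N := fun i hi => Finset.subset_biUnion_of_mem t hi
  have hNpos : 0 < N.card := by
    obtain ⟨i, hi⟩ := hS
    exact ((ne i).mono (hsub i hi)).card_pos
  have hex : ∀ i ∈ S, ∃ h ∈ N, h ∉ t i := by
    intro i hi
    obtain ⟨j, hj, hji⟩ := Finset.exists_mem_ne (by omega : 1 < S.card) i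
    obtain ⟨h, h1, h2⟩ := sep i j hji.symm
    exact ⟨h, hsub j hj h1, h2⟩
  have hlt' : ∀ i ∈ S, (t i).card < N.card := by
    intro i hi
    obtain ⟨h, h1, h2⟩ := hex i hi
    exact Finset.card_lt_card ⟨hsub i hi, fun hh => h2 (hh h1)⟩
  let e : β → ℕ := fun h => (S.filter (fun k => h ∈ t k)).card
  have he : ∀ i ∈ S, ∀ h ∈ N, h ∉ t i → e h ≤ (t i).card := by
    intro i hi h hh hhi
    obtain ⟨j, hj, hhj⟩ := Finset.mem_biUnion.mp hh
    refine le_trans (Finset.card_le_card ?_) (D i j h hhj hhi)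
    exact Finset.filter_subset_filter _ (Finset.subset_univ _)
  have hsum1 : ∑ i ∈ S, ∑ h ∈ N.filter (fun h => h ∉ t i),
      (1 : ℚ) / (S.card * (N.card - (t i).card)) = 1 := by
    have : ∀ i ∈ S, ∑ h ∈ N.filter (fun h => h ∉ t i),
      (1 : ℚ) / (S.card * (N.card - (t i).card)) = 1 / S.card := by
      intro i hi
      have h1 : (N.filter (fun h => h ∉ t i)).card = N.card - (t i).card := by
        rw [← Finset.card_sdiff_of_subset (hsub i hi)]
        congr 1
        ext; simp
      rw [Finset.sum_const, h1, nsmul_eq_mul, Nat.cast_sub (hlt' i hi).le]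
      have h2 : ((t i).card : ℚ) < N.card := by exact_mod_cast hlt' i hi
      have h3 : (N.card : ℚ) - (t i).card ≠ 0 := by linarith
      have h4 : (S.card : ℚ) ≠ 0 := by exact_mod_cast hS.card_pos.ne'
      field_simp
    rw [Finset.sum_congr rfl this, Finset.sum_const, nsmul_eq_mul]
    have h4 : (S.card : ℚ) ≠ 0 := by exact_mod_cast hS.card_pos.ne'
    field_simp
  have hes : ∀ h, e h < S.card := by
    intro h
    have h1 : e h ≤ S.card := Finset.card_filter_le _ _
    refine lt_of_le_of_ne h1 fun h2 => ?_
    have h3 := X S (by omega) ⟨h, Finset.card_filter_eq_iff.mp h2⟩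
    rw [← hN] at h3
    omega
  have hsum2 : ∑ h ∈ N, ∑ i ∈ S.filter (fun i => h ∉ t i),
      (1 : ℚ) / (N.card * (S.card - e h)) = 1 := by
    have : ∀ h ∈ N, ∑ i ∈ S.filter (fun i => h ∉ t i),
      (1 : ℚ) / (N.card * (S.card - e h)) = 1 / N.card := by
      intro h hh
      have h1 : (S.filter (fun i => h ∉ t i)).card + e h = S.card := by
        have := Finset.card_filter_add_card_filter_not (s := S) (fun k => h ∈ t k)
        simp only [e]; omega
      have h1' : ((S.filter (fun i => h ∉ t i)).card : ℚ) = S.card - e h := by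
        rw [← h1]; push_cast; ring
      rw [Finset.sum_const, nsmul_eq_mul, h1']
      have h4 : (0 : ℚ) < N.card := by exact_mod_cast hNpos
      have h6 : (e h : ℚ) < S.card := by exact_mod_cast hes h
      have h5 : (S.card : ℚ) - e h ≠ 0 := by linarith
      field_simp
    rw [Finset.sum_congr rfl this, Finset.sum_const, nsmul_eq_mul]
    have h4 : (0 : ℚ) < N.card := by exact_mod_cast hNpos
    field_simp
  have hswap : ∑ h ∈ N, ∑ i ∈ S.filter (fun i => h ∉ t i),
      (1 : ℚ) / (N.card * (S.card - e h)) = ∑ i ∈ S, ∑ h ∈ N.filter (fun h => h ∉ t i),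
      (1 : ℚ) / (N.card * (S.card - e h)) := by
    apply Finset.sum_comm'
    intro a b; simp only [Finset.mem_filter]; tauto
  have hlast : ∑ i ∈ S, ∑ h ∈ N.filter (fun h => h ∉ t i),
      (1 : ℚ) / (N.card * (S.card - e h)) < ∑ i ∈ S, ∑ h ∈ N.filter (fun h => h ∉ t i),
      (1 : ℚ) / (S.card * (N.card - (t i).card)) := by
    refine Finset.sum_lt_sum_of_nonempty hS fun i hi => ?_
    obtain ⟨h0, h01, h02⟩ := hex i hi
    refine Finset.sum_lt_sum_of_nonempty ⟨h0, by simp [h01, h02]⟩ fun h hh => ?_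
    rw [Finset.mem_filter] at hh
    have e1 : (e h : ℚ) ≤ (t i).card := by exact_mod_cast he i hi h hh.1 hh.2
    have e2 : ((t i).card : ℚ) < N.card := by exact_mod_cast hlt' i hi
    have e3 : (N.card : ℚ) < S.card := by exact_mod_cast hlt
    have e4 : (0 : ℚ) < (t i).card := by exact_mod_cast (ne i).card_pos
    have e5 : (0 : ℚ) < N.card := by exact_mod_cast hNpos
    have e6 : (0 : ℚ) ≤ e h := Nat.cast_nonneg _
    apply one_div_lt_one_div_of_lt
    · exact mul_pos (by linarith) (by linarith)
    · nlinarith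
  rw [hsum1, ← hswap, hsum2] at hlast
  exact absurd hlast (lt_irrefl _)


set_option linter.unusedSectionVars false
set_option linter.unusedVariables false
section lat
variable {L : Type u} [CompleteLattice L] [WellFoundedGT L] [WellFoundedLT L]

/-- Working form of the geometric lattice axioms. -/
structure G (L : Type u) [CompleteLattice L] : Prop where
  sm : ∀ a b c : L, a ⋖ b → a ⋖ c → b ≠ c → b ⋖ b ⊔ c
  atm : ∀ z w : L, ¬ z ≤ w → ∃ p, IsAtom p ∧ p ≤ z ∧ ¬ p ≤ w

theorem cov_aux (hG : G L) (z y x : L) (hxy : x ⋖ y) (hxz : x ≤ z) (hyz : ¬ y ≤ z) :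
    z ⋖ z ⊔ y := by
  induction x using WellFoundedGT.induction generalizing y with
  | ind x ih =>
  rcases hxz.eq_or_lt with h | h
  · subst h
    rwa [sup_eq_right.mpr hxy.le]
  · obtain ⟨x', h1, h2⟩ := exists_covBy_le_of_lt h
    have hne : x' ≠ y := by rintro rfl; exact hyz h2
    have h3 := hG.sm x x' y h1 hxy hne
    have h4 := ih x' h1.lt (x' ⊔ y) h3 h2 (fun h => hyz (le_sup_right.trans h))
    rwa [← sup_assoc, sup_eq_left.mpr h2] at h4

theorem cov (hG : G L) {z y x : L} (hxy : x ⋖ y) (hxz : x ≤ z) (hyz : ¬ y ≤ z) :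
    z ⋖ z ⊔ y := cov_aux hG z y x hxy hxz hyz

theorem cov_eq {a b c : L} (hb : a ⋖ b) (hc : a ⋖ c) (h : b ≤ c) : b = c := by
  rcases hc.eq_or_eq hb.le h with h | h
  · exact absurd h hb.lt.ne'
  · exact h

theorem exch (hG : G L) {x y p z : L} (hy : x ⋖ y) (hp : x ⋖ p) (hz : x ≤ z) (hyz : ¬ y ≤ z)
    (h : y ≤ z ⊔ p) : p ≤ z ⊔ y := by
  have h1 := cov hG hy hz hyz
  have h2 : ¬ p ≤ z := fun h' => hyz (h.trans (sup_le le_rfl h'))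
  have h3 := cov hG hp hz h2
  rw [cov_eq h1 h3 (sup_le le_sup_left h)]
  exact le_sup_right

theorem exists_cov (hG : G L) {x z w : L} (hxz : x ≤ z) (hxw : x ≤ w) (h : ¬ z ≤ w) :
    ∃ y, x ⋖ y ∧ y ≤ z ∧ ¬ y ≤ w := by
  obtain ⟨p, hp, h1, h2⟩ := hG.atm z w h
  refine ⟨x ⊔ p, cov hG hp.bot_covBy bot_le fun h => h2 (h.trans hxw), sup_le hxz h1,
    fun h => h2 (le_sup_right.trans h)⟩

theorem exists_max (P : L → Prop) (a : L) (ha : P a) :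
    ∃ m, P m ∧ ∀ m', P m' → m ≤ m' → m' = m := by
  obtain ⟨m, h1, h2⟩ := (wellFounded_gt (α := L)).has_min {m | P m} ⟨a, ha⟩
  refine ⟨m, h1, fun m' h3 h4 => ?_⟩
  by_contra hne
  exact h2 m' h3 (lt_of_le_of_ne h4 (Ne.symm hne))

/-- Separation by a coatom of `[x, z]`. -/
theorem sep (hG : G L) {x w v z : L} (hxw : x ≤ w) (hxv : x ≤ v) (hwz : w ≤ z) (hvz : v ≤ z)
    (h : ¬ v ≤ w) : ∃ k, k ⋖ z ∧ w ≤ k ∧ ¬ v ≤ k := by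
  obtain ⟨m, ⟨h1, h2, h3⟩, h4⟩ :=
    exists_max (fun m : L => w ≤ m ∧ m ≤ z ∧ ¬ v ≤ m) w ⟨le_rfl, hwz, h⟩
  have hxm := hxw.trans h1
  refine ⟨m, ?_, h1, h3⟩
  obtain ⟨q, q1, q2, q3⟩ := exists_cov hG hxv hxm h3
  have hc := cov hG q1 hxm q3
  have hle : m ⊔ q ≤ z := sup_le h2 (q2.trans hvz)
  by_cases hz : z ≤ m ⊔ q
  · rwa [le_antisymm hle hz] at hc
  · exfalso
    obtain ⟨p, p1, p2, p3⟩ := exists_cov hG (hxm.trans h2) (hxm.trans le_sup_left) hz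
    have hv : v ≤ m ⊔ p := by
      by_contra hv
      have := h4 (m ⊔ p) ⟨h1.trans le_sup_left, sup_le h2 p2, hv⟩ le_sup_left
      exact p3 (le_trans (sup_eq_left.mp this) le_sup_left)
    exact p3 (exch hG q1 p1 hxm q3 (q2.trans hv))

def M (x z : L) : Prop :=
  ∃ f : L → L, (∀ y, x ⋖ y → y ≤ z → y ≤ f y ∧ f y ⋖ z) ∧
    ∀ y y', x ⋖ y → y ≤ z → x ⋖ y' → y' ≤ z → f y = f y' → y = y'

def W (y z : L) : Prop :=
  ∃ g : L → L, (∀ e, y ⋖ e → e ≤ z → y ≤ g e ∧ g e ⋖ z) ∧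
    ∀ e e', y ⋖ e → e ≤ z → y ⋖ e' → e' ≤ z → g e = g e' → e = e'

theorem W_of (y z : L) (hyz : y < z) (h : ¬ y ⋖ z → M y z) : W y z := by
  by_cases hc : y ⋖ z
  · refine ⟨fun _ => y, fun e _ _ => ⟨le_rfl, hc⟩, fun e e' h1 h2 h3 h4 _ => ?_⟩
    rw [cov_eq h1 hc h2, cov_eq h3 hc h4]
  · obtain ⟨f, h1, h2⟩ := h hc
    exact ⟨f, fun e he hz => ⟨he.le.trans (h1 e he hz).1, (h1 e he hz).2⟩, h2⟩

/-- Injection from the points of a hyperplane `k` to the hyperplanes over a point `y` off `k`. -/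
theorem deg (hG : G L) {x y z k : L} (hxy : x ⋖ y) (hyz : y ≤ z) (hk : k ⋖ z)
    (hyk : ¬ y ≤ k) (hW : W y z) :
    ∃ φ : L → L, (∀ c, x ⋖ c → c ≤ k → y ≤ φ c ∧ φ c ⋖ z) ∧
      ∀ c c', x ⋖ c → c ≤ k → x ⋖ c' → c' ≤ k → φ c = φ c' → c = c' := by
  obtain ⟨g, g1, g2⟩ := hW
  have hcv : ∀ c, x ⋖ c → c ≤ k → y ⋖ y ⊔ c ∧ y ⊔ c ≤ z := by
    intro c hc hck
    refine ⟨cov hG hc hxy.le fun h => ?_, sup_le hyz (hck.trans hk.le)⟩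
    exact hyk ((cov_eq hc hxy h) ▸ hck)
  refine ⟨fun c => g (y ⊔ c), fun c hc hck => g1 _ (hcv c hc hck).1 (hcv c hc hck).2, ?_⟩
  intro c c' hc hck hc' hck' he
  have h := g2 _ _ (hcv c hc hck).1 (hcv c hc hck).2 (hcv c' hc' hck').1 (hcv c' hc' hck').2 he
  by_contra hne
  have h1 : ¬ c' ≤ c := fun h => hne (cov_eq hc' hc h).symm
  have h2 : c' ≤ c ⊔ y := by rw [sup_comm, h]; exact le_sup_right
  exact hyk ((exch hG hc' hxy hc.le h1 h2).trans (sup_le hck hck'))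

theorem finite_case (hG : G L) {x z : L} (hxz : x < z) (hnc : ¬ x ⋖ z)
    (hfin : {y | x ⋖ y ∧ y ≤ z}.Finite)
    (hW : ∀ y, x ⋖ y → y ≤ z → W y z)
    (ih : ∀ z', z' < z → x < z' → ¬ x ⋖ z' → M x z') : M x z := by
  classical
  have hlt : ∀ y, x ⋖ y → y ≤ z → y < z := by
    intro y hy hyz
    refine lt_of_le_of_ne hyz ?_
    rintro rfl; exact hnc hy
  let A := {y // x ⋖ y ∧ y ≤ z}
  have : Finite A := hfin
  have : Fintype A := Fintype.ofFinite A
  have hco : {k | x ≤ k ∧ k ⋖ z}.Finite := by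
    refine Set.Finite.of_finite_image (f := fun k => {y : A | y.1 ≤ k}) (Set.toFinite _) ?_
    have aux : ∀ k k', x ≤ k → k ⋖ z → x ≤ k' → {y : A | y.1 ≤ k} = {y : A | y.1 ≤ k'} →
        k ≤ k' := by
      intro k k' h1 h2 h3 h
      by_contra hle
      obtain ⟨p, p1, p2, p3⟩ := exists_cov hG h1 h3 hle
      have : (⟨p, p1, p2.trans h2.le⟩ : A) ∈ {y : A | y.1 ≤ k'} := by
        rw [← h]; exact p2
      exact p3 this
    intro k hk k' hk' h
    exact le_antisymm (aux k k' hk.1 hk.2 hk'.1 h) (aux k' k hk'.1 hk'.2 hk.1 h.symm)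
  have hfi : ∀ a : A, {k | a.1 ≤ k ∧ k ⋖ z}.Finite :=
    fun a => hco.subset fun k hk => ⟨a.2.1.le.trans hk.1, hk.2⟩
  let t : A → Finset L := fun a => (hfi a).toFinset
  have ht : ∀ a k, k ∈ t a ↔ a.1 ≤ k ∧ k ⋖ z := by
    intro a k; simp [t]
  have hab : ∀ a b : A, a ≠ b → ¬ a.1 ≤ b.1 := by
    intro a b hab h
    exact hab (Subtype.ext (cov_eq a.2.1 b.2.1 h))
  suffices key : ∃ f : A → L, Function.Injective f ∧ ∀ i, f i ∈ t i by
    obtain ⟨f, f1, f2⟩ := key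
    refine ⟨fun y => if h : x ⋖ y ∧ y ≤ z then f ⟨y, h⟩ else y, ?_, ?_⟩
    · intro y h1 h2
      have := (ht _ _).mp (f2 ⟨y, h1, h2⟩)
      simpa [h1, h2] using this
    · intro y y' h1 h2 h3 h4 h
      simp only [h1, h2, h3, h4, and_self, dite_true] at h
      exact congrArg Subtype.val (f1 h)
  refine hall_conway t ?_ ?_ ?_ ?_
  · intro i j k hk hki
    rw [ht] at hk hki
    have hik : ¬ i.1 ≤ k := fun h => hki ⟨h, hk.2⟩
    obtain ⟨φ, p1, p2⟩ := deg hG i.2.1 i.2.2 hk.2 hik (hW _ i.2.1 i.2.2)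
    refine Finset.card_le_card_of_injOn (fun a => φ a.1) ?_ ?_
    · intro a ha
      have ha' := (ht _ _).mp (by simpa using ha : k ∈ t a)
      exact (ht _ _).mpr (p1 a.1 a.2.1 ha'.1)
    · intro a ha b hb h
      have ha' := (ht _ _).mp (by simpa using ha : k ∈ t a)
      have hb' := (ht _ _).mp (by simpa using hb : k ∈ t b)
      exact Subtype.ext (p2 _ _ a.2.1 ha'.1 b.2.1 hb'.1 h)
  · intro i j hij
    obtain ⟨k, k1, k2, k3⟩ := sep hG j.2.1.le i.2.1.le j.2.2 i.2.2 (hab i j hij)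
    exact ⟨k, (ht _ _).mpr ⟨k2, k1⟩, fun h => k3 ((ht _ _).mp h).1⟩
  · intro i
    obtain ⟨k, k1, k2, k3⟩ := sep hG i.2.1.le hxz.le i.2.2 le_rfl (hlt _ i.2.1 i.2.2).not_ge
    exact ⟨k, (ht _ _).mpr ⟨k2, k1⟩⟩
  · rintro S hS ⟨k, hk⟩
    obtain ⟨a, ha, b, hb, hne⟩ := Finset.one_lt_card.mp hS
    let z' := ⨆ i ∈ S, i.1
    have hz' : ∀ i ∈ S, i.1 ≤ z' := fun i hi => le_iSup₂ (f := fun (i : A) (_ : i ∈ S) => i.1) i hi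
    have hzk : z' ≤ k := iSup₂_le fun i hi => ((ht _ _).mp (hk i hi)).1
    have hzz : z' < z := lt_of_le_of_lt hzk ((ht _ _).mp (hk a ha)).2.lt
    have hxz' : x < z' := a.2.1.lt.trans_le (hz' a ha)
    have hn' : ¬ x ⋖ z' := by
      intro h
      have h1 := cov_eq a.2.1 h (hz' a ha)
      have h2 := cov_eq b.2.1 h (hz' b hb)
      exact hne (Subtype.ext (h1.trans h2.symm))
    obtain ⟨f, f1, f2⟩ := ih z' hzz hxz' hn'
    have hext : ∀ i : A, ∃ k', i ∈ S → k' ⋖ z ∧ i.1 ≤ k' ∧ k' ⊓ z' = f i.1 := by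
      intro i
      by_cases hi : i ∈ S
      · have h1 := f1 i.1 i.2.1 (hz' i hi)
        obtain ⟨k', k1, k2, k3⟩ := sep hG (i.2.1.le.trans h1.1) hxz'.le (h1.2.le.trans hzz.le)
          hzz.le h1.2.lt.not_ge
        refine ⟨k', fun _ => ⟨k1, h1.1.trans k2, ?_⟩⟩
        rcases h1.2.eq_or_eq (le_inf k2 h1.2.le) inf_le_right with h | h
        · exact h
        · exact absurd (inf_eq_right.mp h) k3
      · exact ⟨x, fun h => absurd h hi⟩
    choose ψ hψ using hext
    refine Finset.card_le_card_of_injOn ψ ?_ ?_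
    · intro i hi
      have := hψ i hi
      exact Finset.mem_biUnion.mpr ⟨i, hi, (ht _ _).mpr ⟨this.2.1, this.1⟩⟩
    · intro i hi j hj h
      have h1 := (hψ i hi).2.2
      rw [h, (hψ j hj).2.2] at h1
      exact Subtype.ext (f2 _ _ j.2.1 (hz' j hj) i.2.1 (hz' i hi) h1).symm

theorem card_remove {β : Type u} {κ : Cardinal.{u}} (hκ : Cardinal.aleph0 ≤ κ) {s t : Set β} (p : β)
    (hst : s ⊆ insert p t) (hs : κ ≤ Cardinal.mk s) : κ ≤ Cardinal.mk t := by
  by_contra hlt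
  rw [not_le] at hlt
  have h1 : Cardinal.mk s ≤ Cardinal.mk t + 1 :=
    (Cardinal.mk_le_mk_of_subset hst).trans Cardinal.mk_insert_le
  have h2 : Cardinal.mk t + 1 < κ :=
    Cardinal.add_lt_of_lt hκ hlt (Cardinal.one_lt_aleph0.trans_le hκ)
  exact absurd (hs.trans h1) (not_le.mpr h2)

theorem finish {x z : L} (B : L → Prop) (S : Set L) (f0 : L → L)
    (h0 : ∀ y, x ⋖ y → y ≤ z → B y → y ≤ f0 y ∧ f0 y ⋖ z ∧ f0 y ∈ S)
    (inj0 : ∀ y y', x ⋖ y → y ≤ z → B y → x ⋖ y' → y' ≤ z → B y' → f0 y = f0 y' → y = y')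
    (hT : ∀ c, x ⋖ c → c ≤ z → ¬ B c →
      Cardinal.mk {y | x ⋖ y ∧ y ≤ z} ≤ Cardinal.mk {k | c ≤ k ∧ k ⋖ z ∧ k ∉ S}) : M x z := by
  classical
  obtain ⟨g, g1, g2⟩ := greedy (ι := {y // (x ⋖ y ∧ y ≤ z) ∧ ¬ B y})
    (fun c => {k | c.1 ≤ k ∧ k ⋖ z ∧ k ∉ S}) (fun c => le_trans
      (Cardinal.mk_le_mk_of_subset (s := {y | (x ⋖ y ∧ y ≤ z) ∧ ¬ B y}) (fun y hy => hy.1))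
      (hT c.1 c.2.1.1 c.2.1.2 c.2.2))
  refine ⟨fun y => if h : (x ⋖ y ∧ y ≤ z) ∧ ¬ B y then g ⟨y, h⟩ else f0 y, ?_, ?_⟩
  · intro y h1 h2
    by_cases hB : B y
    · have := h0 y h1 h2 hB
      simpa [hB] using ⟨this.1, this.2.1⟩
    · have := g2 ⟨y, ⟨h1, h2⟩, hB⟩
      simpa [h1, h2, hB] using ⟨this.1, this.2.1⟩
  · intro y y' h1 h2 h3 h4 h
    by_cases hB : B y <;> by_cases hB' : B y' <;>
      simp only [h1, h2, h3, h4, hB, hB', and_self, not_true_eq_false, not_false_eq_true,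
        and_false, dite_true, dite_false] at h
    · exact inj0 y y' h1 h2 hB h3 h4 hB' h
    · exact absurd (h ▸ (h0 y h1 h2 hB).2.2) (g2 ⟨y', ⟨h3, h4⟩, hB'⟩).2.2
    · exact absurd (h ▸ (h0 y' h3 h4 hB').2.2) (g2 ⟨y, ⟨h1, h2⟩, hB⟩).2.2
    · exact congrArg Subtype.val (g1 h)

/-- `l` is a line over `x`. -/
structure Line (x l : L) : Prop where
  cv : ∀ a, x ⋖ a → a ≤ l → a ⋖ l
  jn : ∀ a a', x ⋖ a → a ≤ l → x ⋖ a' → a' ≤ l → a ≠ a' → a ⊔ a' = l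
  two : ∀ a, x ⋖ a → a ≤ l → ∃ a', x ⋖ a' ∧ a' ≤ l ∧ a ≠ a'

theorem line_of (hG : G L) {x a1 a2 : L} (h1 : x ⋖ a1) (h2 : x ⋖ a2) (hne : a1 ≠ a2) :
    Line x (a1 ⊔ a2) := by
  have c1 := hG.sm x a1 a2 h1 h2 hne
  have cv : ∀ a, x ⋖ a → a ≤ a1 ⊔ a2 → a ⋖ a1 ⊔ a2 := by
    intro a ha hal
    by_cases h : a = a1
    · rwa [h]
    · have e := cov_eq (hG.sm x a1 a h1 ha (Ne.symm h)) c1 (sup_le le_sup_left hal)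
      have := hG.sm x a a1 ha h1 h
      rwa [sup_comm, e] at this
  refine ⟨cv, ?_, ?_⟩
  · intro a a' ha hal ha' hal' hn
    exact cov_eq (hG.sm x a a' ha ha' hn) (cv a ha hal) (sup_le hal hal')
  · intro a ha hal
    by_cases h : a = a1
    · exact ⟨a2, h2, le_sup_right, h ▸ hne⟩
    · exact ⟨a1, h1, le_sup_left, h⟩

theorem compl (hG : G L) {x l z c : L} (hl : Line x l) (hlz : l ≤ z) (hc : x ⋖ c) (hcz : c ≤ z)
    (hcl : ¬ c ≤ l) : ∃ m, c ≤ m ∧ m ≤ z ∧ (∀ a, x ⋖ a → a ≤ l → ¬ l ≤ m ⊔ a) ∧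
      (∀ a, x ⋖ a → a ≤ l → m ⊔ a ⋖ z) := by
  obtain ⟨m, ⟨h1, h2, h3⟩, h4⟩ := exists_max
    (fun m : L => c ≤ m ∧ m ≤ z ∧ ∀ a, x ⋖ a → a ≤ l → ¬ l ≤ m ⊔ a) c ⟨le_rfl, hcz, by
      intro a ha hal hle
      have hne : a ≠ c := by rintro rfl; exact hcl hal
      have := hG.sm x a c ha hc hne
      rw [sup_comm] at hle
      exact hcl (by rw [cov_eq (hl.cv a ha hal) this hle]; exact le_sup_right)⟩
  have hxm : x ≤ m := hc.le.trans h1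
  refine ⟨m, h1, h2, h3, ?_⟩
  intro a ha hal
  obtain ⟨a', ha', hal', hne⟩ := hl.two a ha hal
  have hj := hl.jn a a' ha hal ha' hal' hne
  have hna : ¬ a' ≤ m ⊔ a := fun h => h3 a ha hal (hj ▸ sup_le le_sup_right h)
  have hcv := cov hG ha' (hxm.trans le_sup_left) hna
  have hle : m ⊔ a ⊔ a' ≤ z := sup_le (sup_le h2 (hal.trans hlz)) (hal'.trans hlz)
  suffices z ≤ m ⊔ a ⊔ a' by rwa [le_antisymm hle this] at hcv
  by_contra hz
  obtain ⟨p, p1, p2, p3⟩ := exists_cov hG (hxm.trans h2)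
    (hxm.trans (le_sup_left.trans le_sup_left)) hz
  rw [sup_assoc, hj] at p3
  have := h4 (m ⊔ p) ⟨h1.trans le_sup_left, sup_le h2 p2, ?_⟩ le_sup_left
  · exact p3 (le_trans (sup_eq_left.mp this) le_sup_left)
  · intro b hb hbl hle
    obtain ⟨b', hb', hbl', hne'⟩ := hl.two b hb hbl
    have hjb := hl.jn b b' hb hbl hb' hbl' hne'
    have hnb : ¬ b' ≤ m ⊔ b := fun h => h3 b hb hbl (hjb ▸ sup_le le_sup_right h)
    have h5 : b' ≤ m ⊔ b ⊔ p := hbl'.trans (hle.trans (by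
      rw [sup_assoc, sup_assoc, sup_comm p b]))
    have := exch hG hb' p1 (hxm.trans le_sup_left) hnb h5
    rw [sup_assoc, hjb] at this
    exact p3 this

/-- The case of a line with as many points as there are points in total. -/
theorem line_case (hG : G L) {x l z : L} (hl : Line x l) (hlz : l < z)
    (hinf : Cardinal.aleph0 ≤ Cardinal.mk {y | x ⋖ y ∧ y ≤ z})
    (hcard : Cardinal.mk {y | x ⋖ y ∧ y ≤ z} ≤ Cardinal.mk {y | x ⋖ y ∧ y ≤ l})
    (hM : ¬ l ⋖ z → M l z) : M x z := by
  classical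
  obtain ⟨⟨a0, ha0, hal0⟩⟩ : Nonempty {y | x ⋖ y ∧ y ≤ l} := by
    rw [← Cardinal.mk_ne_zero_iff]
    exact (Cardinal.aleph0_pos.trans_le (hinf.trans hcard)).ne'
  have hxl : x ≤ l := ha0.le.trans hal0
  obtain ⟨c0, hc0, hcz0, hcl0⟩ := exists_cov hG (hxl.trans hlz.le) hxl hlz.not_ge
  obtain ⟨m, m1, m2, m3, m4⟩ := compl hG hl hlz.le hc0 hcz0 hcl0
  have hxm : x ≤ m := hc0.le.trans m1
  have ham : ∀ a, x ⋖ a → a ≤ l → ¬ a ≤ m := by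
    intro a ha hal ham
    obtain ⟨a', ha', hal', hne⟩ := hl.two a ha hal
    refine m3 a' ha' hal' ?_
    rw [← hl.jn a a' ha hal ha' hal' hne]
    exact sup_le_sup_right ham _
  have hinja : ∀ m', (∀ a, x ⋖ a → a ≤ l → ¬ l ≤ m' ⊔ a) → ∀ a a', x ⋖ a → a ≤ l → x ⋖ a' →
      a' ≤ l → m' ⊔ a = m' ⊔ a' → a = a' := by
    intro m' hm' a a' ha hal ha' hal' h
    by_contra hne
    refine hm' a ha hal ?_
    rw [← hl.jn a a' ha hal ha' hal' hne]
    exact sup_le le_sup_right (h ▸ le_sup_right)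
  have hcl : ∀ c, x ⋖ c → c ≤ m → l ⋖ l ⊔ c ∧ l ⊔ c ≤ z := by
    intro c hc hcm
    exact ⟨cov hG hc hxl fun h => ham c hc h hcm, sup_le hlz.le (hcm.trans m2)⟩
  have hinjc : ∀ c c', x ⋖ c → c ≤ m → x ⋖ c' → c' ≤ m → l ⊔ c = l ⊔ c' → c = c' := by
    intro c c' hc hcm hc' hcm' h
    by_contra hne
    obtain ⟨a', ha', hal', hna⟩ := hl.two a0 ha0 hal0
    have hj := hl.jn a0 a' ha0 hal0 ha' hal' hna
    have h1 : ¬ c' ≤ c := fun h => hne (cov_eq hc' hc h).symm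
    have h2 : ¬ c' ≤ c ⊔ a0 := fun h2 =>
      ham a0 ha0 hal0 ((exch hG hc' ha0 hc.le h1 h2).trans (sup_le hcm hcm'))
    have h3 : c' ≤ c ⊔ a0 ⊔ a' := by
      rw [sup_assoc, hj, sup_comm, h]; exact le_sup_right
    have h4 := exch hG hc' ha' (hc.le.trans le_sup_left) h2 h3
    refine m3 a0 ha0 hal0 ?_
    rw [← hj]
    refine sup_le le_sup_right (h4.trans ?_)
    exact sup_le (sup_le_sup_right hcm _) (hcm'.trans le_sup_left)
  have hrest : ∀ c, x ⋖ c → c ≤ z → ¬ (c ≤ l ∨ c ≤ m) →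
      Cardinal.mk {y | x ⋖ y ∧ y ≤ z} ≤
        Cardinal.mk {k | c ≤ k ∧ k ⋖ z ∧ k ∉ {k | l ≤ k ∨ m ≤ k}} := by
    intro c hc hcz hn
    push Not at hn
    obtain ⟨n, n1, n2, n3, n4⟩ := compl hG hl hlz.le hc hcz hn.1
    refine card_remove hinf (s := (fun a => n ⊔ a) '' {y | x ⋖ y ∧ y ≤ l}) (m ⊔ c) ?_ ?_
    · rintro _ ⟨a, ⟨ha, hal⟩, rfl⟩
      by_cases hm : m ≤ n ⊔ a
      · left
        have h1 : m ⊔ c ≤ n ⊔ a := sup_le hm (n1.trans le_sup_left)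
        have h2 : m ⋖ m ⊔ c := cov hG hc hxm hn.2
        have h3 : m ⋖ m ⊔ a := cov hG ha hxm (ham a ha hal)
        have h4 : m ⊔ c ⋖ z := by
          by_cases he : m ⊔ c = m ⊔ a
          · rw [he]; exact m4 a ha hal
          · have h5 := hG.sm _ _ _ h2 h3 he
            have h6 := hG.sm _ _ _ h3 h2 (Ne.symm he)
            have h7 := cov_eq h6 (m4 a ha hal) (sup_le (m4 a ha hal).le (sup_le m2 hcz))
            rwa [sup_comm (m ⊔ c) (m ⊔ a), h7] at h5
        rcases h4.eq_or_eq h1 (n4 a ha hal).le with h | h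
        · exact h
        · exact absurd h (n4 a ha hal).lt.ne
      · right
        refine ⟨n1.trans le_sup_left, n4 a ha hal, ?_⟩
        rintro (h | h)
        · exact n3 a ha hal h
        · exact hm h
    · rw [Cardinal.mk_image_eq_of_injOn]
      · exact hcard
      · intro a ha a' ha' h
        exact hinja n n3 a a' ha.1 ha.2 ha'.1 ha'.2 h
  by_cases hlc : l ⋖ z
  · have huniq : ∀ c c', x ⋖ c → c ≤ m → x ⋖ c' → c' ≤ m → c = c' := by
      intro c c' hc hcm hc' hcm'
      refine hinjc c c' hc hcm hc' hcm' ?_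
      rw [cov_eq (hcl c hc hcm).1 hlc (hcl c hc hcm).2,
        cov_eq (hcl c' hc' hcm').1 hlc (hcl c' hc' hcm').2]
    have hlm : ∀ a, x ⋖ a → a ≤ l → m ⊔ a ≠ l := fun a ha hal h => m3 a ha hal h.ge
    refine finish (fun c => c ≤ l ∨ c ≤ m) {k | l ≤ k ∨ m ≤ k}
      (fun c => if c = a0 then l else if c ≤ l then m ⊔ c else m ⊔ a0) ?_ ?_ hrest
    · intro y hy hyz hB
      split_ifs with h1 h2
      · exact ⟨h1 ▸ hal0, hlc, Or.inl le_rfl⟩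
      · exact ⟨le_sup_right, m4 y hy h2, Or.inr le_sup_left⟩
      · exact ⟨(hB.resolve_left h2).trans le_sup_left, m4 a0 ha0 hal0, Or.inr le_sup_left⟩
    · intro y y' hy hyz hB hy' hyz' hB' h
      split_ifs at h with h1 h2 h3 h4 h5 h6 h7 h8
      · rw [h1, h2]
      · exact absurd h.symm (hlm _ hy' h3)
      · exact absurd h.symm (hlm _ ha0 hal0)
      · exact absurd h (hlm _ hy h4)
      · exact hinja m m3 _ _ hy h4 hy' h6 h
      · exact absurd (hinja m m3 _ _ hy h4 ha0 hal0 h) h1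
      · exact absurd h (hlm _ ha0 hal0)
      · exact absurd (hinja m m3 _ _ ha0 hal0 hy' h8 h).symm h7
      · exact huniq _ _ hy (hB.resolve_left h4) hy' (hB'.resolve_left h8)
  · obtain ⟨g, g1, g2⟩ := hM hlc
    have hgl : ∀ c, x ⋖ c → c ≤ m → l ⊔ c ≤ g (l ⊔ c) ∧ g (l ⊔ c) ⋖ z :=
      fun c hc hcm => g1 _ (hcl c hc hcm).1 (hcl c hc hcm).2
    refine finish (fun c => c ≤ l ∨ c ≤ m) {k | l ≤ k ∨ m ≤ k}
      (fun c => if c ≤ l then m ⊔ c else g (l ⊔ c)) ?_ ?_ hrest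
    · intro y hy hyz hB
      split_ifs with h2
      · exact ⟨le_sup_right, m4 y hy h2, Or.inr le_sup_left⟩
      · have := hgl y hy (hB.resolve_left h2)
        exact ⟨le_sup_right.trans this.1, this.2, Or.inl (le_sup_left.trans this.1)⟩
    · intro y y' hy hyz hB hy' hyz' hB' h
      split_ifs at h with h1 h2 h2
      · exact hinja m m3 _ _ hy h1 hy' h2 h
      · have := hgl y' hy' (hB'.resolve_left h2)
        exact absurd (h ▸ le_sup_left.trans this.1) (m3 y hy h1)
      · have := hgl y hy (hB.resolve_left h1)
        exact absurd (h ▸ le_sup_left.trans this.1) (m3 y' hy' h2)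
      · have k1 := hB.resolve_left h1
        have k2 := hB'.resolve_left h2
        exact hinjc _ _ hy k1 hy' k2 (g2 _ _ (hcl y hy k1).1 (hcl y hy k1).2 (hcl y' hy' k2).1
          (hcl y' hy' k2).2 h)

theorem infinite_case (hG : G L) {x z : L} (hxz : x < z) (hnc : ¬ x ⋖ z)
    (hinf : Cardinal.aleph0 ≤ Cardinal.mk {y | x ⋖ y ∧ y ≤ z})
    (hW : ∀ y, x ⋖ y → y ≤ z → W y z)
    (ih : ∀ y, x < y → y < z → ¬ y ⋖ z → M y z) : M x z := by
  classical
  set κ := Cardinal.mk {y | x ⋖ y ∧ y ≤ z} with hκ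
  have hlt : ∀ y, x ⋖ y → y ≤ z → y < z := by
    intro y hy hyz
    refine lt_of_le_of_ne hyz ?_
    rintro rfl; exact hnc hy
  let bad : L → Prop := fun y => x ⋖ y ∧ y ≤ z ∧ Cardinal.mk {k | y ≤ k ∧ k ⋖ z} < κ
  by_cases hone : ∀ y y', bad y → bad y' → y = y'
  · have hpick : ∀ y, ∃ k, x ⋖ y → y ≤ z → y ≤ k ∧ k ⋖ z := by
      intro y
      by_cases h : x ⋖ y ∧ y ≤ z
      · obtain ⟨k, k1, k2, k3⟩ := sep hG h.1.le hxz.le h.2 le_rfl (hlt _ h.1 h.2).not_ge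
        exact ⟨k, fun _ _ => ⟨k2, k1⟩⟩
      · exact ⟨x, fun h1 h2 => absurd ⟨h1, h2⟩ h⟩
    choose f0 hf0 using hpick
    refine finish bad (f0 '' {y | bad y}) f0 ?_ (fun y y' _ _ h _ _ h' _ => hone y y' h h') ?_
    · intro y hy hyz hb
      exact ⟨(hf0 y hy hyz).1, (hf0 y hy hyz).2, y, hb, rfl⟩
    · intro c hc hcz hnb
      have hge : κ ≤ Cardinal.mk {k | c ≤ k ∧ k ⋖ z} := by
        by_contra h
        exact hnb ⟨hc, hcz, not_le.mp h⟩
      by_cases hex : ∃ b, bad b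
      · obtain ⟨b, hb⟩ := hex
        refine card_remove hinf (f0 b) ?_ hge
        intro k hk
        by_cases hkb : k = f0 b
        · exact Or.inl hkb
        · refine Or.inr ⟨hk.1, hk.2, ?_⟩
          rintro ⟨b', hb', rfl⟩
          exact hkb (by rw [hone b' b hb' hb])
      · refine hge.trans (Cardinal.mk_le_mk_of_subset fun k hk => ⟨hk.1, hk.2, ?_⟩)
        rintro ⟨b', hb', rfl⟩
        exact hex ⟨b', hb'⟩
  · push Not at hone
    obtain ⟨y, y', hy, hy', hne⟩ := hone
    have hfew : ∀ y, bad y → Cardinal.mk {e | y ⋖ e ∧ e ≤ z} < κ := by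
      rintro y ⟨h1, h2, h3⟩
      obtain ⟨g, g1, g2⟩ := hW y h1 h2
      refine lt_of_le_of_lt ?_ h3
      refine Cardinal.mk_le_of_injective
        (f := fun e : {e | y ⋖ e ∧ e ≤ z} => (⟨g e.1, g1 e.1 e.2.1 e.2.2⟩ : {k | y ≤ k ∧ k ⋖ z})) ?_
      intro e e' h
      exact Subtype.ext (g2 _ _ e.2.1 e.2.2 e'.2.1 e'.2.2 (congrArg Subtype.val h))
    have hl := line_of hG hy.1 hy'.1 hne
    have hlz : y ⊔ y' ≤ z := sup_le hy.2.1 hy'.2.1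
    rcases hlz.eq_or_lt with heq | hlz
    · rw [heq] at hl
      exact ⟨fun c => c, fun c hc hcz => ⟨le_rfl, hl.cv c hc hcz⟩, fun _ _ _ _ _ _ h => h⟩
    · have hoff : Cardinal.mk {c | (x ⋖ c ∧ c ≤ z) ∧ ¬ c ≤ y ⊔ y'} < κ := by
        refine lt_of_le_of_lt ?_ (Cardinal.mul_lt_of_lt hinf (hfew y hy) (hfew y' hy'))
        rw [Cardinal.mul_def]
        have hcv : ∀ w, bad w → w ≤ y ⊔ y' → ∀ c, x ⋖ c → c ≤ z → ¬ c ≤ y ⊔ y' →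
            w ⋖ w ⊔ c ∧ w ⊔ c ≤ z := fun w hw hwl c hc hcz hcl =>
          ⟨cov hG hc hw.1.le fun h => hcl (h.trans hwl), sup_le hw.2.1 hcz⟩
        refine Cardinal.mk_le_of_injective
          (f := fun c : {c | (x ⋖ c ∧ c ≤ z) ∧ ¬ c ≤ y ⊔ y'} =>
            ((⟨y ⊔ c.1, hcv y hy le_sup_left c.1 c.2.1.1 c.2.1.2 c.2.2⟩,
              ⟨y' ⊔ c.1, hcv y' hy' le_sup_right c.1 c.2.1.1 c.2.1.2 c.2.2⟩) :
            {e | y ⋖ e ∧ e ≤ z} × {e | y' ⋖ e ∧ e ≤ z})) ?_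
        rintro ⟨c, ⟨hc, hcz⟩, hcl⟩ ⟨c', ⟨hc', hcz'⟩, hcl'⟩ h
        simp only [Prod.mk.injEq, Subtype.mk.injEq] at h
        obtain ⟨e1, e2⟩ := h
        rw [Subtype.mk.injEq]
        by_contra hcc
        have aux : ∀ w, bad w → w ≤ y ⊔ y' → w ⊔ c = w ⊔ c' → c ⊔ c' = c ⊔ w := by
          intro w hw hwl h
          have hcw : c ≠ w := by rintro rfl; exact hcl hwl
          refine cov_eq (hG.sm x c c' hc hc' hcc) (hG.sm x c w hc hw.1 hcw)
            (sup_le le_sup_left ?_)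
          rw [sup_comm c w, h]; exact le_sup_right
        have a1 := aux y hy le_sup_left e1
        have a2 := aux y' hy' le_sup_right e2
        have hle : y ⊔ y' ≤ y ⊔ c := by
          refine sup_le le_sup_left ?_
          rw [sup_comm y c, ← a1, a2]; exact le_sup_right
        have := cov_eq (hl.cv y hy.1 le_sup_left) (hcv y hy le_sup_left c hc hcz hcl).1 hle
        exact hcl (this ▸ le_sup_right)
      refine line_case hG hl hlz hinf ?_ (ih _ (hy.1.lt.trans_le le_sup_left) hlz)
      by_contra hcon
      rw [not_le] at hcon
      have hun : {c | x ⋖ c ∧ c ≤ z} ⊆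
          {c | x ⋖ c ∧ c ≤ y ⊔ y'} ∪ {c | (x ⋖ c ∧ c ≤ z) ∧ ¬ c ≤ y ⊔ y'} := by
        intro c hc
        by_cases h : c ≤ y ⊔ y'
        · exact Or.inl ⟨hc.1, h⟩
        · exact Or.inr ⟨hc, h⟩
      have h1 := (Cardinal.mk_le_mk_of_subset hun).trans (Cardinal.mk_union_le _ _)
      exact absurd h1 (not_le.mpr (Cardinal.add_lt_of_lt hinf hcon hoff))

theorem main (hG : G L) (x : L) : ∀ z : L, x < z → ¬ x ⋖ z → M x z := by
  induction x using WellFoundedGT.induction with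
  | ind x ihx =>
  intro z
  induction z using WellFoundedLT.induction with
  | ind z ihz =>
  intro hxz hnc
  have hW : ∀ y, x ⋖ y → y ≤ z → W y z := by
    intro y hy hyz
    have hlt : y < z := lt_of_le_of_ne hyz (by rintro rfl; exact hnc hy)
    exact W_of y z hlt (ihx y hy.lt z hlt)
  by_cases hfin : {y | x ⋖ y ∧ y ≤ z}.Finite
  · exact finite_case hG hxz hnc hfin hW fun z' h1 h2 h3 => ihz z' h1 h2 h3
  · refine infinite_case hG hxz hnc ?_ hW fun y h1 h2 h3 => ihx y h1 z h2 h3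
    have : Infinite {y | x ⋖ y ∧ y ≤ z} := Set.infinite_coe_iff.mpr hfin
    exact Cardinal.aleph0_le_mk _

end lat

theorem wf_aux {L : Type u} [PartialOrder L]
    (h : ∀ c : Set L, IsChain (· ≤ ·) c → c.Finite) : WellFoundedLT L ∧ WellFoundedGT L := by
  constructor
  · refine ⟨RelEmbedding.wellFounded_iff_isEmpty.mpr ⟨fun e => ?_⟩⟩
    refine Set.infinite_range_of_injective e.injective (h _ ?_)
    rintro _ ⟨i, rfl⟩ _ ⟨j, rfl⟩ hne
    rcases lt_trichotomy i j with hij | hij | hij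
    · exact Or.inr (e.map_rel_iff.mpr hij).le
    · exact absurd (congrArg e hij) hne
    · exact Or.inl (e.map_rel_iff.mpr hij).le
  · refine ⟨RelEmbedding.wellFounded_iff_isEmpty.mpr ⟨fun e => ?_⟩⟩
    refine Set.infinite_range_of_injective e.injective (h _ ?_)
    rintro _ ⟨i, rfl⟩ _ ⟨j, rfl⟩ hne
    rcases lt_trichotomy i j with hij | hij | hij
    · exact Or.inl (le_of_lt (e.map_rel_iff.mpr hij : e j > e i))
    · exact absurd (congrArg e hij) hne
    · exact Or.inr (le_of_lt (e.map_rel_iff.mpr hij : e i > e j))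

end GeomMatch

/-- Every geometric lattice of finite rank greater than 1 has a matching. -/
theorem geometric_lattice_matching (L : Type u) [CompleteLattice L]
    (hL : IsGeomLatFH L) (r : L → ℕ) (hr : IsRankFn r) (hrank : 1 < r ⊤) :
    HasMatching L := by
  obtain ⟨-, -, hch, hsm, hat⟩ := hL
  obtain ⟨w1, w2⟩ := GeomMatch.wf_aux hch
  have hG : GeomMatch.G L := by
    constructor
    · intro a b c hb hc hne
      obtain ⟨d, h1, h2⟩ := hsm a b c hb hc hne
      rwa [h1.wcovBy.sup_eq h2.wcovBy hne]
    · intro z w hzw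
      obtain ⟨S, hS, hlub⟩ := hat z
      by_contra hcon
      push Not at hcon
      refine hzw (hlub.2 fun p hp => hcon p ?_ (hlub.1 hp))
      obtain ⟨o, ho, hop⟩ := hS p hp
      rw [le_antisymm (ho ⊥) bot_le] at hop
      exact bot_covBy_iff.mp hop
  have h1 : (⊥ : L) < ⊤ := by
    refine lt_of_le_of_ne bot_le fun h => ?_
    rw [← h, hr.1] at hrank
    omega
  have h2 : ¬ (⊥ : L) ⋖ ⊤ := by
    intro h
    rw [hr.2 _ _ h, hr.1] at hrank
    omega
  obtain ⟨f, f1, f2⟩ := GeomMatch.main hG ⊥ ⊤ h1 h2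
  have hf := fun a : {a : L // IsAtom a} => f1 a.1 a.2.bot_covBy le_top
  refine ⟨fun a => ⟨f a.1, covBy_top_iff.mp (hf a).2⟩, ?_, fun a => (hf a).1⟩
  intro a b hab
  exact Subtype.ext (f2 _ _ a.2.bot_covBy le_top b.2.bot_covBy le_top (congrArg Subtype.val hab))
end
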